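/- arXiv:2406.16816 — 2 statements merged into one kernel-verified Lean document; each statement's English description precedes it below -/
import Mathlib

section
/- Assume k ≥ 2 and let S be a nonempty finite subset of Fin N with |S| = m. Then ξ₁(S) ≤ (k − 1) + ξ₂ᵇˡ(S); consequently, combining with the paper's Lemma 3, ξ₁(S) ≤ k + B_k(m). -/
open Matrix

/-- Squared Frobenius norm `‖A‖_F² = trace(Aᵀ A)`. -/
noncomputable def frobSq {m n : Type*} [Fintype m] [Fintype n] (A : Matrix m n ℝ) : ℝ :=
  Matrix.trace (Aᵀ * A)

/-- `ω(x) = (√x + 1/√x)²/4`, from the Kantorovich inequality. -/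
noncomputable def omegaFn (x : ℝ) : ℝ := (Real.sqrt x + 1 / Real.sqrt x) ^ 2 / 4

/-- The `j`-th eigenvalue `λⱼ` of the Laplacian, 1-indexed (with `λⱼ = 0` for `j ≤ 0` since
`λ₁ = 0`, and `0` beyond `N`). -/
noncomputable def eig1 {N : ℕ} (lam : Fin N → ℝ) (j : ℕ) : ℝ :=
  if h : j - 1 < N then lam ⟨j - 1, h⟩ else 0

/-- `B_k(m) = r_bl·(N/m) + ∑_{i=2}^{m} ω(max(1, λ_{k+2−i}/λᵢ))` where `r_bl = ω(λ_k/λ₂)`. -/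
noncomputable def Bbl {N : ℕ} (lam : Fin N → ℝ) (k m : ℕ) : ℝ :=
  omegaFn (eig1 lam k / eig1 lam 2) * ((N : ℝ) / (m : ℝ)) +
    ∑ i ∈ Finset.Icc 2 m, omegaFn (max 1 (eig1 lam (k + 2 - i) / eig1 lam i))


/-- Cauchy–Schwarz on the nonzero eigenvalues. -/
lemma trace_sq_le_rank {N : ℕ} (X : Matrix (Fin N) (Fin N) ℝ) (hX : Xᵀ = X) :
    (trace X) ^ 2 ≤ (X.rank : ℝ) * trace (X * X) := by
  have hH : X.IsHermitian := by
    rw [Matrix.IsHermitian, Matrix.conjTranspose_eq_transpose_of_trivial, hX]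
  have h1 : trace X = ∑ i, hH.eigenvalues i := by
    have := hH.trace_eq_sum_eigenvalues
    simpa using this
  have h2 : trace (X * X) = ∑ i, hH.eigenvalues i ^ 2 := by
    set U : Matrix (Fin N) (Fin N) ℝ := (hH.eigenvectorUnitary : Matrix (Fin N) (Fin N) ℝ) with hU
    have hs : X = U * diagonal hH.eigenvalues * star U := by
      have := hH.spectral_theorem
      rw [Unitary.conjStarAlgAut_apply] at this
      simpa using this
    have hUU : star U * U = 1 := by
      exact Unitary.coe_star_mul_self hH.eigenvectorUnitary
    have : X * X = U * (diagonal hH.eigenvalues * diagonal hH.eigenvalues) * star U := by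
      conv_lhs => rw [hs]
      calc U * diagonal hH.eigenvalues * star U * (U * diagonal hH.eigenvalues * star U)
          = U * diagonal hH.eigenvalues * (star U * U) * (diagonal hH.eigenvalues * star U) := by
            simp only [Matrix.mul_assoc]
        _ = _ := by rw [hUU]; simp only [Matrix.mul_assoc, Matrix.one_mul]
    rw [this, Matrix.trace_mul_comm, ← Matrix.mul_assoc, hUU, Matrix.one_mul,
      Matrix.diagonal_mul_diagonal, Matrix.trace_diagonal]
    simp [sq]
  have h3 : X.rank = (Finset.univ.filter fun i => hH.eigenvalues i ≠ 0).card := by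
    rw [hH.rank_eq_card_non_zero_eigs, Fintype.card_subtype]
  rw [h1, h2, h3]
  have e1 : ∑ i, hH.eigenvalues i =
      ∑ i ∈ Finset.univ.filter (fun i => hH.eigenvalues i ≠ 0), hH.eigenvalues i := by
    rw [Finset.sum_filter_ne_zero]
  have e2 : ∑ i ∈ Finset.univ.filter (fun i => hH.eigenvalues i ≠ 0), hH.eigenvalues i ^ 2
      ≤ ∑ i, hH.eigenvalues i ^ 2 :=
    Finset.sum_le_sum_of_subset_of_nonneg (Finset.subset_univ _) (fun i _ _ => sq_nonneg _)
  rw [e1]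
  refine (sq_sum_le_card_mul_sum_sq).trans ?_
  exact mul_le_mul_of_nonneg_left e2 (Nat.cast_nonneg _)

lemma trace_mul_self_symm {N : ℕ} (X : Matrix (Fin N) (Fin N) ℝ) (hX : Xᵀ = X) :
    trace (X * X) = ∑ i, ∑ j, X i j ^ 2 := by
  simp only [trace, diag_apply, mul_apply]
  refine Finset.sum_congr rfl fun i _ => Finset.sum_congr rfl fun j _ => ?_
  have : X j i = X i j := congrFun (congrFun hX i) j
  rw [this, sq]

lemma rank_sum_le {N r : ℕ} (T : Matrix (Fin N) (Fin N) ℝ) (hT : Tᵀ = T)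
    (hTT : ∀ i, ∑ j, T i j ^ 2 ≤ T i i) (hr : T.rank ≤ r) :
    ∑ i, ∑ j, T i j ^ 2 ≤ r := by
  have h1 := trace_sq_le_rank T hT
  rw [trace_mul_self_symm T hT] at h1
  have h2 : ∑ i, ∑ j, T i j ^ 2 ≤ trace T := Finset.sum_le_sum fun i _ => hTT i
  have h0 : 0 ≤ ∑ i, ∑ j, T i j ^ 2 :=
    Finset.sum_nonneg fun i _ => Finset.sum_nonneg fun j _ => sq_nonneg _
  have hr' : (T.rank : ℝ) ≤ r := by exact_mod_cast hr
  have hr0 : (0 : ℝ) ≤ T.rank := Nat.cast_nonneg _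
  set q := ∑ i, ∑ j, T i j ^ 2
  rcases h0.eq_or_lt with h | h
  · rw [← h]; exact Nat.cast_nonneg _
  · have : q * q ≤ T.rank * q := by nlinarith
    have := le_of_mul_le_mul_right this h
    linarith

lemma rank_block_le {N r : ℕ} (T : Matrix (Fin N) (Fin N) ℝ) (hT : Tᵀ = T)
    (hTT : ∀ i, ∑ j, T i j ^ 2 ≤ T i i) (hr : T.rank ≤ r)
    (I J : Finset (Fin N)) (hIJ : Disjoint I J) :
    ∑ i ∈ I, ∑ j ∈ J, T i j ^ 2 ≤ ((min r I.card : ℕ) : ℝ) / 4 := by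
  classical
  set E : Matrix (Fin N) (Fin N) ℝ := diagonal fun i => if i ∈ I then 1 else 0 with hE
  set X := E * T * E with hX
  have hXe : ∀ i j, X i j = if i ∈ I then (if j ∈ I then T i j else 0) else 0 := by
    intro i j
    rw [hX, hE, mul_diagonal, diagonal_mul]
    split_ifs <;> simp
  have hXs : Xᵀ = X := by
    ext i j
    have : T j i = T i j := congrFun (congrFun hT i) j
    rw [transpose_apply, hXe, hXe, this]
    split_ifs <;> rfl
  have hEr : E.rank = I.card := by
    rw [hE, rank_diagonal, Fintype.card_subtype]
    congr 1; ext i; simp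
  have hXr : X.rank ≤ min r I.card := by
    refine le_min ?_ ?_
    · exact ((rank_mul_le_left _ _).trans (rank_mul_le_right _ _)).trans hr
    · rw [← hEr]; exact rank_mul_le_right _ _
  have h1 := trace_sq_le_rank X hXs
  rw [trace_mul_self_symm X hXs] at h1
  have h2 : ∑ i, ∑ j, X i j ^ 2 = ∑ i ∈ I, ∑ j ∈ I, T i j ^ 2 := by
    simp only [hXe]
    rw [← Finset.sum_subset (Finset.subset_univ I)]
    · refine Finset.sum_congr rfl fun i hi => ?_
      rw [← Finset.sum_subset (Finset.subset_univ I)]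
      · refine Finset.sum_congr rfl fun j hj => ?_
        simp [hi, hj]
      · intro j _ hj; simp [hj]
    · intro i _ hi; simp [hi]
  have h3 : trace X = ∑ i ∈ I, T i i := by
    simp only [trace, diag_apply, hXe]
    rw [← Finset.sum_filter]
    simp
  rw [h2, h3] at h1
  have h4 : ∑ i ∈ I, ∑ j ∈ J, T i j ^ 2 + ∑ i ∈ I, ∑ j ∈ I, T i j ^ 2 ≤ ∑ i ∈ I, T i i := by
    rw [← Finset.sum_add_distrib]
    refine Finset.sum_le_sum fun i _ => ?_
    refine le_trans ?_ (hTT i)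
    rw [add_comm, ← Finset.sum_union hIJ]
    exact Finset.sum_le_sum_of_subset_of_nonneg (Finset.subset_univ _) (fun _ _ _ => sq_nonneg _)
  have hr' : (X.rank : ℝ) ≤ (min r I.card : ℕ) := by exact_mod_cast hXr
  set ρ : ℝ := ((min r I.card : ℕ) : ℝ)
  set q := ∑ i ∈ I, ∑ j ∈ I, T i j ^ 2
  set t := ∑ i ∈ I, T i i
  have hq : 0 ≤ q := Finset.sum_nonneg fun i _ => Finset.sum_nonneg fun j _ => sq_nonneg _
  have h5 : t ^ 2 ≤ ρ * q := h1.trans (mul_le_mul_of_nonneg_right hr' hq)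
  have hρ : 0 ≤ ρ := Nat.cast_nonneg _
  have : t - q ≤ ρ / 4 := by
    rcases hρ.eq_or_lt with h | h
    · rw [← h] at h5 ⊢
      have : t = 0 := by nlinarith
      rw [this]; linarith
    · have : ρ * (t - q) ≤ ρ * (ρ / 4) := by nlinarith [sq_nonneg (t - ρ / 2)]
      exact le_of_mul_le_mul_left this h
  linarith

lemma rank_block_le' {N r : ℕ} (T : Matrix (Fin N) (Fin N) ℝ) (hT : Tᵀ = T)
    (hTT : ∀ i, ∑ j, T i j ^ 2 ≤ T i i) (hr : T.rank ≤ r)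
    (I J : Finset (Fin N)) (hIJ : Disjoint I J) :
    ∑ i ∈ I, ∑ j ∈ J, T i j ^ 2 ≤ ((min r (min I.card J.card) : ℕ) : ℝ) / 4 := by
  have h1 := rank_block_le T hT hTT hr I J hIJ
  have h2 := rank_block_le T hT hTT hr J I hIJ.symm
  rw [Finset.sum_comm] at h2
  have h3 : ∀ i j, T j i = T i j := fun i j => congrFun (congrFun hT i) j
  simp only [h3] at h2
  rcases le_total I.card J.card with h | h
  · rwa [min_eq_left h]
  · rw [min_eq_right h]
    refine le_trans (le_of_eq ?_) h2
    refine Finset.sum_congr rfl fun i hi => Finset.sum_congr rfl fun j hj => ?_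
    rfl

lemma telescope_mono (x : ℕ → ℝ) (n i j : ℕ) (hij : i ≤ j) (hj : j < n) :
    x j - x i = ∑ p ∈ Finset.range n, if i ≤ p ∧ p < j then x (p + 1) - x p else 0 := by
  rw [← Finset.sum_filter]
  have : (Finset.range n).filter (fun p => i ≤ p ∧ p < j) = Finset.Ico i j := by
    ext p; simp; omega
  rw [this, Finset.sum_Ico_sub x hij]

lemma prod_telescope (x y : ℕ → ℝ) (n i j : ℕ) (hij : i ≤ j) (hj : j < n) :
    (x j - x i) * (y i - y j) = ∑ p ∈ Finset.range n, ∑ q ∈ Finset.range n,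
      if (i ≤ min p q ∧ max p q < j) then (x (p + 1) - x p) * (y q - y (q + 1)) else 0 := by
  have h2 : y i - y j = ∑ q ∈ Finset.range n, if i ≤ q ∧ q < j then y q - y (q + 1) else 0 := by
    have := telescope_mono (fun l => - y l) n i j hij hj
    have e : y i - y j = -y j - -y i := by ring
    rw [e, this]
    refine Finset.sum_congr rfl fun q _ => ?_
    split_ifs <;> ring
  rw [telescope_mono x n i j hij hj, h2, Finset.sum_mul_sum]
  refine Finset.sum_congr rfl fun p _ => Finset.sum_congr rfl fun q _ => ?_
  by_cases h1 : i ≤ p ∧ p < j <;> by_cases h3 : i ≤ q ∧ q < j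
  · rw [if_pos h1, if_pos h3, if_pos (by omega)]
  · rw [if_pos h1, if_neg h3, if_neg (by omega), mul_zero]
  · rw [if_neg h1, zero_mul, if_neg (by omega)]
  · rw [if_neg h1, zero_mul, if_neg (by omega)]

/-- Layer-cake rearrangement bound. -/
lemma layer_cake (n r : ℕ) (x y : ℕ → ℝ) (s : ℕ → ℕ → ℝ)
    (hx : ∀ p, p + 1 < n → x p ≤ x (p + 1)) (hy : ∀ p, p + 1 < n → y (p + 1) ≤ y p)
    (hs : ∀ a b, a ≤ b → b + 1 < n →
      ∑ i ∈ Finset.range n, ∑ j ∈ Finset.range n, (if i ≤ a ∧ b < j then s i j else 0)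
        ≤ ((min r (min (a + 1) (n - 1 - b)) : ℕ) : ℝ) / 4) :
    ∑ i ∈ Finset.range n, ∑ j ∈ Finset.range n,
        (if i < j then s i j * ((x j - x i) * (y i - y j)) else 0)
      ≤ ∑ l ∈ Finset.range r,
        (if l < n - 1 - l then
          (x (n - 1 - l) - x l) * (y l - y (n - 1 - l)) / 4 else 0) := by
  have hL : ∑ i ∈ Finset.range n, ∑ j ∈ Finset.range n,
        (if i < j then s i j * ((x j - x i) * (y i - y j)) else 0)
      = ∑ p ∈ Finset.range n, ∑ q ∈ Finset.range n,
        ((x (p + 1) - x p) * (y q - y (q + 1))) *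
          ∑ i ∈ Finset.range n, ∑ j ∈ Finset.range n,
            (if i ≤ min p q ∧ max p q < j then s i j else 0) := by
    have : ∀ i ∈ Finset.range n, ∀ j ∈ Finset.range n,
        (if i < j then s i j * ((x j - x i) * (y i - y j)) else 0)
        = ∑ p ∈ Finset.range n, ∑ q ∈ Finset.range n,
          ((x (p + 1) - x p) * (y q - y (q + 1))) *
            (if i ≤ min p q ∧ max p q < j then s i j else 0) := by
      intro i _ j hj
      by_cases hij : i < j
      · rw [if_pos hij, prod_telescope x y n i j hij.le (Finset.mem_range.1 hj), Finset.mul_sum]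
        refine Finset.sum_congr rfl fun p _ => ?_
        rw [Finset.mul_sum]
        refine Finset.sum_congr rfl fun q _ => ?_
        split_ifs <;> ring
      · rw [if_neg hij]
        symm
        refine Finset.sum_eq_zero fun p _ => Finset.sum_eq_zero fun q _ => ?_
        rw [if_neg (by omega), mul_zero]
    rw [Finset.sum_congr rfl fun i hi => Finset.sum_congr rfl fun j hj => this i hi j hj]
    simp only [Finset.mul_sum]
    rw [Finset.sum_congr rfl fun i _ => Finset.sum_comm, Finset.sum_comm]
    refine Finset.sum_congr rfl fun p _ => ?_
    rw [Finset.sum_congr rfl fun i _ => Finset.sum_comm, Finset.sum_comm]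
  have hR : ∑ l ∈ Finset.range r,
        (if l < n - 1 - l then
          (x (n - 1 - l) - x l) * (y l - y (n - 1 - l)) / 4 else 0)
      = ∑ p ∈ Finset.range n, ∑ q ∈ Finset.range n,
        ((x (p + 1) - x p) * (y q - y (q + 1))) *
          (((min r (min (min p q + 1) (n - 1 - max p q)) : ℕ) : ℝ) / 4) := by
    have : ∀ l ∈ Finset.range r, (if l < n - 1 - l then
          (x (n - 1 - l) - x l) * (y l - y (n - 1 - l)) / 4 else 0)
        = ∑ p ∈ Finset.range n, ∑ q ∈ Finset.range n,
          ((x (p + 1) - x p) * (y q - y (q + 1))) *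
            (if l ≤ min p q ∧ max p q < n - 1 - l then 1 / 4 else 0) := by
      intro l _
      by_cases hl : l < n - 1 - l
      · rw [if_pos hl, prod_telescope x y n l (n - 1 - l) hl.le (by omega), Finset.sum_div]
        refine Finset.sum_congr rfl fun p _ => ?_
        rw [Finset.sum_div]
        refine Finset.sum_congr rfl fun q _ => ?_
        split_ifs <;> ring
      · rw [if_neg hl]
        symm
        refine Finset.sum_eq_zero fun p _ => Finset.sum_eq_zero fun q _ => ?_
        rw [if_neg (by omega), mul_zero]
    rw [Finset.sum_congr rfl this, Finset.sum_comm]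
    refine Finset.sum_congr rfl fun p _ => ?_
    rw [Finset.sum_comm]
    refine Finset.sum_congr rfl fun q _ => ?_
    rw [← Finset.mul_sum, ← Finset.sum_filter, Finset.sum_const]
    have hc : (Finset.range r).filter (fun l => l ≤ min p q ∧ max p q < n - 1 - l)
        = Finset.range (min r (min (min p q + 1) (n - 1 - max p q))) := by
      ext l; simp only [Finset.mem_filter, Finset.mem_range]; omega
    rw [hc, Finset.card_range, nsmul_eq_mul]
    ring
  rw [hL, hR]
  refine Finset.sum_le_sum fun p hp => Finset.sum_le_sum fun q hq => ?_
  rw [Finset.mem_range] at hp hq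
  by_cases h : max p q + 1 < n
  · refine mul_le_mul_of_nonneg_left (hs _ _ (by omega) h) ?_
    exact mul_nonneg (sub_nonneg.2 (hx p (by omega))) (sub_nonneg.2 (hy q (by omega)))
  · have h0 : n - 1 - max p q = 0 := by omega
    have h1 : ∑ i ∈ Finset.range n, ∑ j ∈ Finset.range n,
            (if i ≤ min p q ∧ max p q < j then s i j else 0) = 0 := by
      refine Finset.sum_eq_zero fun i _ => Finset.sum_eq_zero fun j hj => ?_
      rw [Finset.mem_range] at hj
      rw [if_neg (by omega)]
    rw [h1, h0]; simp

lemma omegaFn_eq {x : ℝ} (hx : 0 < x) : omegaFn x = (x + 2 + 1 / x) / 4 := by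
  unfold omegaFn
  have h := Real.sq_sqrt hx.le
  have h0 : 0 < Real.sqrt x := Real.sqrt_pos.2 hx
  have h2 : (1 / Real.sqrt x) ^ 2 = 1 / x := by rw [div_pow, h, one_pow]
  have h3 : Real.sqrt x * (1 / Real.sqrt x) = 1 := by field_simp
  nlinarith

lemma omegaFn_div {a b : ℝ} (ha : 0 < a) (hb : 0 < b) :
    omegaFn (b / a) = (a + b) ^ 2 / (4 * a * b) := by
  rw [omegaFn_eq (div_pos hb ha)]; field_simp; ring

lemma omegaFn_div' {a b : ℝ} (ha : 0 < a) (hb : 0 < b) :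
    omegaFn (b / a) = 1 + (b - a) * (a⁻¹ - b⁻¹) / 4 := by
  rw [omegaFn_eq (div_pos hb ha)]; field_simp; ring

lemma omegaFn_one : omegaFn 1 = 1 := by rw [omegaFn_eq one_pos]; norm_num

lemma one_le_omegaFn_div {a b : ℝ} (ha : 0 < a) (hb : 0 < b) : 1 ≤ omegaFn (b / a) := by
  rw [omegaFn_div ha hb, le_div_iff₀ (by positivity)]
  nlinarith [sq_nonneg (a - b)]

lemma kant_in {a b l : ℝ} (ha : 0 < a) (hal : a ≤ l) (hlb : l ≤ b) (q v : ℝ) :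
    v ^ 2 + (a + b) * (l⁻¹ * (v * (q - v))) ≤ omegaFn (b / a) * q ^ 2 := by
  have hl : 0 < l := ha.trans_le hal
  have hb : 0 < b := hl.trans_le hlb
  rw [omegaFn_div ha hb]
  have key : 0 ≤ (a + b) ^ 2 * l * q ^ 2 - 4 * a * b * l * v ^ 2
      - 4 * a * b * (a + b) * (v * (q - v)) := by
    have h1 : 0 ≤ (l - a) * (b - l) := mul_nonneg (by linarith) (by linarith)
    have e : ((a + b) ^ 2 * l * q ^ 2 - 4 * a * b * l * v ^ 2
      - 4 * a * b * (a + b) * (v * (q - v))) * l =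
      ((a + b) * l * q - 2 * a * b * v) ^ 2 + 4 * a * b * v ^ 2 * ((l - a) * (b - l)) := by ring
    have : 0 ≤ ((a + b) ^ 2 * l * q ^ 2 - 4 * a * b * l * v ^ 2
      - 4 * a * b * (a + b) * (v * (q - v))) * l := by rw [e]; positivity
    exact nonneg_of_mul_nonneg_left this hl
  have e2 : (a + b) ^ 2 / (4 * a * b) * q ^ 2 - (v ^ 2 + (a + b) * (l⁻¹ * (v * (q - v))))
      = ((a + b) ^ 2 * l * q ^ 2 - 4 * a * b * l * v ^ 2
      - 4 * a * b * (a + b) * (v * (q - v))) / (4 * a * b * l) := by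
    field_simp; try ring
  have : 0 ≤ (a + b) ^ 2 / (4 * a * b) * q ^ 2 - (v ^ 2 + (a + b) * (l⁻¹ * (v * (q - v)))) := by
    rw [e2]; positivity
  linarith

lemma kant_out {a b l : ℝ} (ha : 0 < a) (hab : a ≤ b) (hbl : b ≤ l) (q v : ℝ) :
    (a + b) * (l⁻¹ * (v * (q - v))) ≤ omegaFn (b / a) * q ^ 2 := by
  have hb : 0 < b := ha.trans_le hab
  have hl : 0 < l := hb.trans_le hbl
  have h1 := one_le_omegaFn_div ha hb
  have h2 : v * (q - v) ≤ q ^ 2 / 4 := by nlinarith [sq_nonneg (q - 2 * v)]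
  have h3 : (a + b) * l⁻¹ ≤ 2 := by
    rw [← div_eq_mul_inv, div_le_iff₀ hl]; linarith
  have h4 : 0 ≤ (a + b) * l⁻¹ := by positivity
  calc (a + b) * (l⁻¹ * (v * (q - v))) = ((a + b) * l⁻¹) * (v * (q - v)) := by ring
    _ ≤ ((a + b) * l⁻¹) * (q ^ 2 / 4) := mul_le_mul_of_nonneg_left h2 h4
    _ ≤ 2 * (q ^ 2 / 4) := mul_le_mul_of_nonneg_right h3 (by positivity)
    _ ≤ omegaFn (b / a) * q ^ 2 := by nlinarith [sq_nonneg q]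

lemma tmat_key {N : ℕ} (lam : Fin N → ℝ) (hlam : ∀ i, 0 ≤ lam i) (z : Fin N) (hz : lam z = 0)
    (μ : ℝ) (hμ : 0 < μ) (Q M : Matrix (Fin N) (Fin N) ℝ) (hQ : Qᵀ = Q) (hM : Mᵀ = M)
    (hQQ : Q * Q = Q) (hQM : Q * M = 1 - μ • (diagonal lam * M))
    (T : Matrix (Fin N) (Fin N) ℝ)
    (hTdef : T = diagonal (fun i => if i = z then 0 else 1) -
      μ • (diagonal (fun i => Real.sqrt (lam i)) * M * diagonal (fun i => Real.sqrt (lam i)))) :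
    Tᵀ = T ∧ ∀ i, ∑ j, T i j ^ 2 ≤ T i i := by
  set D : Matrix (Fin N) (Fin N) ℝ := diagonal (fun i => Real.sqrt (lam i)) with hD
  set J : Matrix (Fin N) (Fin N) ℝ := diagonal (fun i => if i = z then 0 else 1) with hJ
  have hDt : Dᵀ = D := diagonal_transpose _
  have hJt : Jᵀ = J := diagonal_transpose _
  have hDD : D * D = diagonal lam := by
    rw [hD, diagonal_mul_diagonal]; congr 1; ext i; exact Real.mul_self_sqrt (hlam i)
  have hJD : J * D = D := by
    rw [hD, hJ, diagonal_mul_diagonal]; congr 1; ext i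
    split_ifs with h
    · rw [h, hz]; simp
    · simp
  have hDJ : D * J = D := by
    rw [hD, hJ, diagonal_mul_diagonal]; congr 1; ext i
    split_ifs with h
    · rw [h, hz]; simp
    · simp
  have hJJ : J * J = J := by
    rw [hJ, diagonal_mul_diagonal]; congr 1; ext i
    split_ifs <;> simp
  have hTt : Tᵀ = T := by
    rw [hTdef, transpose_sub, transpose_smul, transpose_mul, transpose_mul, hDt, hJt, hM,
      Matrix.mul_assoc]
  refine ⟨hTt, fun i => ?_⟩
  have hC : (Q * M * D)ᵀ * (Q * M * D) = D * M * D - μ • (D * M * D * (D * M * D)) := by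
    rw [transpose_mul, transpose_mul, hQ, hM, hDt]
    calc D * (M * Q) * (Q * M * D) = D * M * (Q * Q * M) * D := by
          simp only [Matrix.mul_assoc]
      _ = _ := by
          rw [hQQ, hQM, Matrix.mul_sub, Matrix.sub_mul, ← hDD]
          simp only [Matrix.mul_assoc, Matrix.mul_one, Matrix.mul_smul, Matrix.smul_mul]
  have hT2 : T * T = T - μ • ((Q * M * D)ᵀ * (Q * M * D)) := by
    rw [hC, hTdef]
    set Y := D * M * D with hY
    have h1 : J * Y = Y := by rw [hY, ← Matrix.mul_assoc, ← Matrix.mul_assoc, hJD]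
    have h2 : Y * J = Y := by rw [hY, Matrix.mul_assoc, hDJ]
    rw [Matrix.mul_sub, Matrix.sub_mul, Matrix.sub_mul, hJJ, Matrix.mul_smul, Matrix.smul_mul,
      Matrix.smul_mul, Matrix.mul_smul, h1, h2, smul_sub]
    first | done | abel
  have h3 : ∑ j, T i j ^ 2 = (T * T) i i := by
    rw [mul_apply]
    refine Finset.sum_congr rfl fun j _ => ?_
    have : T j i = T i j := congrFun (congrFun hTt i) j
    rw [this, sq]
  rw [h3, hT2, Matrix.sub_apply, Matrix.smul_apply, mul_apply, smul_eq_mul]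
  have : 0 ≤ ∑ j, (Q * M * D)ᵀ i j * (Q * M * D) j i :=
    Finset.sum_nonneg fun j _ => by rw [transpose_apply]; exact mul_self_nonneg _
  have := mul_nonneg hμ.le this
  linarith

lemma first_row_bound {N : ℕ} (lam : Fin N → ℝ) (z : Fin N) (hz : lam z = 0)
    (hpos : ∀ j, j ≠ z → 0 < lam j)
    (μ : ℝ) (hμ : 0 < μ) (Q M : Matrix (Fin N) (Fin N) ℝ) (hQ : Qᵀ = Q)
    (hQQ : Q * Q = Q) (hQM : Q * M = 1 - μ • (diagonal lam * M))
    (κ : ℝ) (hκ : κ * Q z z = 1) (K : Finset (Fin N)) (a b : ℝ) (ha : 0 < a)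
    (hab : a ≤ b)
    (hKin : ∀ j ∈ K, j ≠ z → a ≤ lam j ∧ lam j ≤ b) (hKout : ∀ j ∉ K, j ≠ z → b ≤ lam j) :
    ∑ j ∈ K, (Q * M) j z ^ 2 ≤ omegaFn (b / a) * κ := by
  have hQs : ∀ i j, Q j i = Q i j := fun i j => congrFun (congrFun hQ i) j
  have hv : ∀ j, (Q * M) j z = (if j = z then 1 else 0) - μ * (lam j * M j z) := by
    intro j
    rw [hQM, Matrix.sub_apply, Matrix.smul_apply, diagonal_mul, one_apply, smul_eq_mul]
  set v : Fin N → ℝ := fun j => (Q * M) j z with hvdef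
  set q : Fin N → ℝ := fun j => κ * Q j z with hqdef
  have hvz : v z = 1 := by simp only [hvdef]; rw [hv, hz]; simp
  have hqz : q z = 1 := hκ
  have hqq : ∑ j, q j ^ 2 = κ := by
    have : (Q * Q) z z = Q z z := by rw [hQQ]
    rw [mul_apply] at this
    have e : ∑ j, q j ^ 2 = κ ^ 2 * ∑ j, Q z j * Q j z := by
      rw [Finset.mul_sum]
      refine Finset.sum_congr rfl fun j _ => ?_
      simp only [hqdef]; rw [hQs j z]; ring
    rw [e, this, sq, mul_assoc, hκ, mul_one]
  have hvq : ∑ j, v j * q j = κ := by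
    have : (Q * (Q * M)) z z = 1 := by rw [← Matrix.mul_assoc, hQQ]; exact hvz
    rw [mul_apply] at this
    have e : ∑ j, v j * q j = κ * ∑ j, Q z j * (Q * M) j z := by
      rw [Finset.mul_sum]
      refine Finset.sum_congr rfl fun j _ => ?_
      simp only [hqdef, hvdef]; rw [hQs j z]; ring
    rw [e, this, mul_one]
  have hwq : ∑ j, M j z * q j = κ := by
    have : (Q * M) z z = 1 := hvz
    rw [mul_apply] at this
    have e : ∑ j, M j z * q j = κ * ∑ j, Q z j * M j z := by
      rw [Finset.mul_sum]
      refine Finset.sum_congr rfl fun j _ => ?_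
      simp only [hqdef]; rw [hQs j z]; ring
    rw [e, this, mul_one]
  have hwv : ∑ j, M j z * v j = ∑ j, v j ^ 2 := by
    have e1 : ∑ j, M j z * v j = (Mᵀ * (Q * M)) z z := by
      rw [mul_apply]; rfl
    have e2 : ∑ j, v j ^ 2 = ((Q * M)ᵀ * (Q * M)) z z := by
      rw [mul_apply]
      refine Finset.sum_congr rfl fun j _ => ?_
      simp only [hvdef, transpose_apply]; ring
    rw [e1, e2, transpose_mul, hQ]
    congr 2
    rw [Matrix.mul_assoc, ← Matrix.mul_assoc Q Q M, hQQ]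
  have hvv : κ ≤ ∑ j, v j ^ 2 := by
    have h0 : 0 ≤ ∑ j, (v j - q j) ^ 2 := Finset.sum_nonneg fun _ _ => sq_nonneg _
    have e : ∑ j, (v j - q j) ^ 2 = ∑ j, v j ^ 2 - 2 * ∑ j, v j * q j + ∑ j, q j ^ 2 := by
      rw [Finset.mul_sum, ← Finset.sum_sub_distrib, ← Finset.sum_add_distrib]
      refine Finset.sum_congr rfl fun j _ => ?_
      ring
    rw [e, hvq, hqq] at h0
    linarith
  have hkey : 0 ≤ ∑ j, (lam j)⁻¹ * (v j * (q j - v j)) := by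
    have e : ∀ j, (lam j)⁻¹ * (v j * (q j - v j)) = μ * (M j z * v j - M j z * q j) := by
      intro j
      by_cases hj : j = z
      · subst hj; rw [hz, hvz, hqz]; simp
      · have hl := hpos j hj
        have : v j = - (μ * (lam j * M j z)) := by
          simp only [hvdef]; rw [hv, if_neg hj]; ring
        have e2 : (lam j)⁻¹ * v j = - (μ * M j z) := by rw [this]; field_simp
        rw [← mul_assoc, e2]; ring
    rw [Finset.sum_congr rfl fun j _ => e j, ← Finset.mul_sum, Finset.sum_sub_distrib, hwv, hwq]
    exact mul_nonneg hμ.le (by linarith)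
  have hω := one_le_omegaFn_div ha (ha.trans_le hab)
  have hterm : ∀ j, (if j ∈ K then v j ^ 2 else 0) + (a + b) * ((lam j)⁻¹ * (v j * (q j - v j)))
      ≤ omegaFn (b / a) * q j ^ 2 := by
    intro j
    by_cases hj : j = z
    · subst hj
      rw [hz, hvz, hqz]
      split_ifs <;> simp <;> linarith
    · by_cases hK : j ∈ K
      · rw [if_pos hK]
        exact kant_in ha (hKin j hK hj).1 (hKin j hK hj).2 _ _
      · rw [if_neg hK, zero_add]
        exact kant_out ha hab (hKout j hK hj) _ _
  have hsum := Finset.sum_le_sum fun j (_ : j ∈ Finset.univ) => hterm j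
  rw [Finset.sum_add_distrib, ← Finset.mul_sum, ← Finset.mul_sum, hqq, ← Finset.sum_filter] at hsum
  have hf : Finset.univ.filter (fun j => j ∈ K) = K := by ext; simp
  rw [hf] at hsum
  have : 0 ≤ (a + b) * ∑ j, (lam j)⁻¹ * (v j * (q j - v j)) :=
    mul_nonneg (by linarith) hkey
  linarith

lemma sum_band (N k : ℕ) (_hk : 1 ≤ k) (hkN : k ≤ N) (g : ℕ → ℝ)
    (h : ∀ i, i < 1 ∨ k ≤ i → g i = 0) :
    ∑ i : Fin N, g i = ∑ i ∈ Finset.range (k - 1), g (i + 1) := by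
  rw [Fin.sum_univ_eq_sum_range g N]
  have : ∑ i ∈ Finset.range N, g i = ∑ i ∈ Finset.Ico 1 k, g i := by
    symm
    refine Finset.sum_subset (fun i hi => ?_) (fun i _ hi => h i ?_)
    · simp at hi ⊢; omega
    · simp at hi; omega
  rw [this, Finset.sum_Ico_eq_sum_range]
  refine Finset.sum_congr rfl fun i _ => by rw [add_comm]

lemma eig1_val {N : ℕ} (lam : Fin N → ℝ) (i : Fin N) : eig1 lam (i.val + 1) = lam i := by
  unfold eig1; simp

lemma symm_sum {N : ℕ} (R : Fin N → Fin N → ℝ) (h : ∀ i, R i i = 0) :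
    ∑ i, ∑ j, R i j = ∑ i, ∑ j, if i < j then R i j + R j i else 0 := by
  have e : ∀ i j, R i j = (if i < j then R i j else 0) + (if j < i then R i j else 0) := by
    intro i j
    rcases lt_trichotomy i j with h1 | h1 | h1
    · simp [h1, h1.not_gt]
    · subst h1; simp [h]
    · simp [h1, h1.not_gt]
  have e2 : ∑ i, ∑ j, R i j = ∑ i, ∑ j, (if i < j then R i j else 0)
      + ∑ i, ∑ j, (if j < i then R i j else 0) := by
    rw [← Finset.sum_add_distrib]
    refine Finset.sum_congr rfl fun i _ => ?_
    rw [← Finset.sum_add_distrib]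
    exact Finset.sum_congr rfl fun j _ => e i j
  rw [e2, Finset.sum_comm (f := fun i j => if j < i then R i j else 0), ← Finset.sum_add_distrib]
  refine Finset.sum_congr rfl fun i _ => ?_
  rw [← Finset.sum_add_distrib]
  refine Finset.sum_congr rfl fun j _ => ?_
  split_ifs <;> simp

lemma band_bound {N k r : ℕ} (hk2 : 2 ≤ k) (hkN : k ≤ N) (hrN : r + 1 ≤ N)
    (lam : Fin N → ℝ) (hmono : StrictMono lam) (hlam0 : lam ⟨0, by omega⟩ = 0)
    (T : Matrix (Fin N) (Fin N) ℝ) (hT : Tᵀ = T)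
    (hTT : ∀ i, ∑ j, T i j ^ 2 ≤ T i i) (hr : T.rank ≤ r)
    (hT0 : ∀ j, T ⟨0, by omega⟩ j = 0) :
    ∑ i, ∑ j, (if j.val < k then lam j * (lam i)⁻¹ * T i j ^ 2 else 0)
      ≤ ∑ i ∈ Finset.Icc 2 (r + 1), omegaFn (max 1 (eig1 lam (k + 2 - i) / eig1 lam i)) := by
  have hTs : ∀ i j, T j i = T i j := fun i j => congrFun (congrFun hT i) j
  set z : Fin N := ⟨0, by omega⟩ with hzdef
  have hpos : ∀ i : Fin N, i ≠ z → 0 < lam i := by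
    intro i hi
    rw [← hlam0]
    refine hmono ?_
    rw [Fin.lt_def]
    have : i.val ≠ 0 := fun h => hi (Fin.ext h)
    simp [hzdef]; omega
  have hT0' : ∀ i, T i z = 0 := fun i => by rw [hTs z i]; exact hT0 i
  set R : Fin N → Fin N → ℝ := fun i j =>
    if i.val < k ∧ j.val < k then T i j ^ 2 * (lam j * (lam i)⁻¹ - 1) else 0 with hR
  have hRd : ∀ i, R i i = 0 := by
    intro i
    simp only [hR]
    by_cases hi : i = z
    · rw [hi, hT0 z]; simp
    · rw [mul_inv_cancel₀ (hpos i hi).ne']; simp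
  have step1 : ∑ i, ∑ j, (if j.val < k then lam j * (lam i)⁻¹ * T i j ^ 2 else 0)
      ≤ ∑ i, ∑ j, T i j ^ 2 + ∑ i, ∑ j, R i j := by
    rw [← Finset.sum_add_distrib]
    refine Finset.sum_le_sum fun i _ => ?_
    rw [← Finset.sum_add_distrib]
    refine Finset.sum_le_sum fun j _ => ?_
    simp only [hR]
    by_cases hj : j.val < k
    · by_cases hi : i.val < k
      · rw [if_pos hj, if_pos ⟨hi, hj⟩]; apply le_of_eq; ring
      · rw [if_pos hj, if_neg (by tauto), add_zero]
        have hiz : i ≠ z := by rintro rfl; simp [hzdef] at hi; omega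
        have hli := hpos i hiz
        have : lam j ≤ lam i := hmono.monotone (Fin.le_def.2 (by omega))
        have h1 : lam j * (lam i)⁻¹ ≤ 1 := by
          rw [← div_eq_mul_inv]; exact (div_le_one hli).2 this
        nlinarith [sq_nonneg (T i j)]
    · rw [if_neg hj, if_neg (by tauto), add_zero]; positivity
  have step2 := rank_sum_le T hT hTT hr
  -- move to natural number indices
  set tn : ℕ → ℕ → ℝ := fun i j => if h : i < N ∧ j < N then T ⟨i, h.1⟩ ⟨j, h.2⟩ ^ 2 else 0 with htn
  have htnv : ∀ i j : Fin N, tn i.val j.val = T i j ^ 2 := by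
    intro i j; simp [htn]
  set ψ : ℕ → ℕ → ℝ := fun i j => (eig1 lam (j + 1) - eig1 lam (i + 1)) *
    ((eig1 lam (i + 1))⁻¹ - (eig1 lam (j + 1))⁻¹) with hψ
  have step3 : ∑ i, ∑ j, R i j = ∑ i ∈ Finset.range (k - 1), ∑ j ∈ Finset.range (k - 1),
      if i < j then tn (i + 1) (j + 1) * ψ (i + 1) (j + 1) else 0 := by
    rw [symm_sum R hRd]
    have e : ∀ i j : Fin N, (if i < j then R i j + R j i else 0) =
        if 1 ≤ i.val ∧ i.val < j.val ∧ j.val < k then tn i.val j.val * ψ i.val j.val else 0 := by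
      intro i j
      by_cases hij : i < j
      · rw [if_pos hij]
        have hij' := Fin.lt_def.1 hij
        by_cases hi : i = z
        · have hi0 : i.val = 0 := by rw [hi]
          rw [if_neg (by omega), hi]
          simp only [hR]
          rw [hT0 j, hT0' j]; simp
        · have hi1 : 1 ≤ i.val := by
            have : i.val ≠ 0 := fun h => hi (Fin.ext h)
            omega
          have hj : j ≠ z := by rintro rfl; simp [hzdef] at hij'
          have hli := hpos i hi
          have hlj := hpos j hj
          by_cases hjk : j.val < k
          · rw [if_pos ⟨hi1, hij', hjk⟩]
            simp only [hR]
            rw [if_pos ⟨by omega, hjk⟩, if_pos ⟨hjk, by omega⟩, hTs i j, htnv]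
            simp only [hψ, eig1_val]
            field_simp; ring
          · rw [if_neg (by tauto)]
            simp only [hR]
            rw [if_neg (by tauto), if_neg (by tauto), add_zero]
      · rw [if_neg hij, if_neg]
        rw [Fin.lt_def] at hij; tauto
    have e1 : ∀ i : Fin N, ∑ j : Fin N, (if i < j then R i j + R j i else 0) =
        (fun i' : ℕ => ∑ j ∈ Finset.range (k - 1), if 1 ≤ i' ∧ i' < j + 1 ∧ j + 1 < k then
          tn i' (j + 1) * ψ i' (j + 1) else 0) i.val := by
      intro i
      rw [Finset.sum_congr rfl fun j _ => e i j]
      exact sum_band N k (by omega) hkN (fun j => if 1 ≤ i.val ∧ i.val < j ∧ j < k then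
          tn i.val j * ψ i.val j else 0) (fun j hj => if_neg (by omega))
    rw [Finset.sum_congr rfl fun i _ => e1 i, sum_band N k (by omega) hkN
      (fun i' : ℕ => ∑ j ∈ Finset.range (k - 1), if 1 ≤ i' ∧ i' < j + 1 ∧ j + 1 < k then
          tn i' (j + 1) * ψ i' (j + 1) else 0)]
    · refine Finset.sum_congr rfl fun i hi => Finset.sum_congr rfl fun j hj => ?_
      rw [Finset.mem_range] at hi hj
      by_cases hij : i < j
      · rw [if_pos hij, if_pos (by omega)]
      · rw [if_neg hij, if_neg (by omega)]
    · intro i hi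
      refine Finset.sum_eq_zero fun j hj => if_neg ?_
      omega
  have heig : ∀ p, p < N → ∃ i : Fin N, i.val = p ∧ eig1 lam (p + 1) = lam i :=
    fun p hp => ⟨⟨p, hp⟩, rfl, eig1_val lam ⟨p, hp⟩⟩
  have emono : ∀ p q, p ≤ q → q < N → eig1 lam (p + 1) ≤ eig1 lam (q + 1) := by
    intro p q hpq hq
    obtain ⟨i, hi, ei⟩ := heig p (by omega)
    obtain ⟨j, hj, ej⟩ := heig q hq
    rw [ei, ej]; exact hmono.monotone (Fin.le_def.2 (by omega))
  have epos : ∀ p, 1 ≤ p → p < N → 0 < eig1 lam (p + 1) := by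
    intro p hp hpN
    obtain ⟨i, hi, ei⟩ := heig p hpN
    rw [ei]; refine hpos i ?_
    rintro rfl; simp [hzdef] at hi; omega
  have step4 := layer_cake (k - 1) r (fun l => eig1 lam (l + 1 + 1))
    (fun l => (eig1 lam (l + 1 + 1))⁻¹) (fun i j => tn (i + 1) (j + 1))
    (fun p hp => emono _ _ (by omega) (by omega))
    (fun p hp => inv_anti₀ (epos _ (by omega) (by omega)) (emono _ _ (by omega) (by omega)))
    (by
      intro a b hab hb
      set I : Finset (Fin N) := Finset.univ.filter fun i => 1 ≤ i.val ∧ i.val ≤ a + 1 with hI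
      set J : Finset (Fin N) := Finset.univ.filter fun j => b + 1 < j.val ∧ j.val < k with hJ
      have hIJ : Disjoint I J := by
        rw [Finset.disjoint_left]; intro i hi hj
        simp [hI, hJ] at hi hj; omega
      have hIc : I.card ≤ a + 1 := by
        have : I.card ≤ (Finset.Icc 1 (a + 1)).card := by
          refine Finset.card_le_card_of_injOn (fun i => i.val) ?_ ?_
          · intro i hi; simp [hI] at hi ⊢; exact hi
          · intro i _ j _ h; exact Fin.ext h
        simpa using this
      have hJc : J.card ≤ k - 1 - 1 - b := by
        have : J.card ≤ (Finset.Ico (b + 2) k).card := by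
          refine Finset.card_le_card_of_injOn (fun i => i.val) ?_ ?_
          · intro i hi; simp [hJ] at hi ⊢; omega
          · intro i _ j _ h; exact Fin.ext h
        rw [Nat.card_Ico] at this; omega
      have hb1 := rank_block_le' T hT hTT hr I J hIJ
      have e : ∑ i ∈ I, ∑ j ∈ J, T i j ^ 2 = ∑ i ∈ Finset.range (k - 1),
          ∑ j ∈ Finset.range (k - 1), if i ≤ a ∧ b < j then tn (i + 1) (j + 1) else 0 := by
        have e1 : ∀ i : Fin N, (if 1 ≤ i.val ∧ i.val ≤ a + 1 then ∑ j ∈ J, T i j ^ 2 else 0) =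
            (fun i' : ℕ => ∑ j ∈ Finset.range (k - 1),
              if (1 ≤ i' ∧ i' ≤ a + 1) ∧ b + 1 < j + 1 ∧ j + 1 < k then tn i' (j + 1) else 0)
              i.val := by
          intro i
          have := sum_band N k (by omega) hkN
            (fun j => if (1 ≤ i.val ∧ i.val ≤ a + 1) ∧ b + 1 < j ∧ j < k then tn i.val j else 0)
            (fun j hj => if_neg (by omega))
          refine Eq.trans ?_ this
          split_ifs with h
          · rw [hJ, Finset.sum_filter]
            refine Finset.sum_congr rfl fun j _ => ?_
            rw [htnv]
            simp only [h, true_and, and_self]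
          · simp only [h, false_and, if_false, Finset.sum_const_zero]
        rw [hI, Finset.sum_filter, Finset.sum_congr rfl fun i _ => e1 i,
          sum_band N k (by omega) hkN (fun i' : ℕ => ∑ j ∈ Finset.range (k - 1),
              if (1 ≤ i' ∧ i' ≤ a + 1) ∧ b + 1 < j + 1 ∧ j + 1 < k then tn i' (j + 1) else 0)]
        · refine Finset.sum_congr rfl fun i hi => Finset.sum_congr rfl fun j hj => ?_
          rw [Finset.mem_range] at hi hj
          by_cases hij : i ≤ a ∧ b < j
          · rw [if_pos hij, if_pos (by omega)]
          · rw [if_neg hij, if_neg (by omega)]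
        · intro i hi
          refine Finset.sum_eq_zero fun j hj => if_neg ?_
          omega
      rw [e] at hb1
      refine hb1.trans ?_
      have : min r (min I.card J.card) ≤ min r (min (a + 1) (k - 1 - 1 - b)) := by omega
      have : ((min r (min I.card J.card) : ℕ) : ℝ)
        ≤ ((min r (min (a + 1) (k - 1 - 1 - b)) : ℕ) : ℝ) := by exact_mod_cast this
      linarith)
  have step5 : ∑ i ∈ Finset.Icc 2 (r + 1), omegaFn (max 1 (eig1 lam (k + 2 - i) / eig1 lam i))
      = ∑ l ∈ Finset.range r, omegaFn (max 1 (eig1 lam (k - l) / eig1 lam (l + 2))) := by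
    have : Finset.Icc 2 (r + 1) = Finset.Ico 2 (r + 2) := by ext i; simp; omega
    rw [this, Finset.sum_Ico_eq_sum_range]
    refine Finset.sum_congr (by congr 1) fun l _ => ?_
    rw [show k + 2 - (2 + l) = k - l by omega, add_comm 2 l]
  have step6 : (r : ℝ) + ∑ l ∈ Finset.range r, (if l < k - 1 - 1 - l then
        (eig1 lam (k - 1 - 1 - l + 1 + 1) - eig1 lam (l + 1 + 1)) *
          ((eig1 lam (l + 1 + 1))⁻¹ - (eig1 lam (k - 1 - 1 - l + 1 + 1))⁻¹) / 4 else 0)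
      ≤ ∑ l ∈ Finset.range r, omegaFn (max 1 (eig1 lam (k - l) / eig1 lam (l + 2))) := by
    have : (r : ℝ) = ∑ l ∈ Finset.range r, (1 : ℝ) := by simp
    rw [this, ← Finset.sum_add_distrib]
    refine Finset.sum_le_sum fun l hl => ?_
    rw [Finset.mem_range] at hl
    have hl2 : 0 < eig1 lam (l + 2) := epos (l + 1) (by omega) (by omega)
    split_ifs with h
    · have h1 : k - 1 - 1 - l + 1 + 1 = k - l := by omega
      have h2 : eig1 lam (l + 2) ≤ eig1 lam (k - l) := by
        have := emono (l + 1) (k - l - 1) (by omega) (by omega)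
        rwa [show k - l - 1 + 1 = k - l by omega] at this
      rw [h1, max_eq_right ((one_le_div hl2).2 h2), omegaFn_div' hl2 (hl2.trans_le h2)]
    · have h2 : eig1 lam (k - l) ≤ eig1 lam (l + 2) := by
        by_cases hkl : 1 ≤ k - l
        · have := emono (k - l - 1) (l + 1) (by omega) (by omega)
          rwa [show k - l - 1 + 1 = k - l by omega] at this
        · have e0 : eig1 lam (k - l) = 0 := by
            rw [show k - l = 0 by omega]
            unfold eig1
            rw [dif_pos (by omega)]
            exact hlam0
          rw [e0]; exact hl2.le
      rw [max_eq_left ((div_le_one hl2).2 h2), omegaFn_one, add_zero]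
  rw [step5]
  rw [step3] at step1
  simp only [hψ] at step1
  linarith [step1, step2, step4, step6]

lemma frobSq_eq {m n : Type*} [Fintype m] [Fintype n] (A : Matrix m n ℝ) :
    frobSq A = ∑ j, ∑ i, A i j ^ 2 := by
  simp only [frobSq, trace, diag_apply, mul_apply, transpose_apply, sq]

lemma sum_castLE {N k : ℕ} (hkN : k ≤ N) (f : Fin N → ℝ) :
    ∑ j : Fin k, f (Fin.castLE hkN j) = ∑ j ∈ Finset.univ.filter (fun j : Fin N => j.val < k), f j := by
  refine Finset.sum_nbij (fun j => Fin.castLE hkN j) ?_ ?_ ?_ ?_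
  · intro j _; simp
  · intro i _ j _ h; exact Fin.castLE_injective hkN h
  · intro j hj
    simp at hj
    exact ⟨⟨j.val, hj⟩, by simp, by ext; simp⟩
  · intro j _; rfl

lemma colsum_orth {N : ℕ} (V X : Matrix (Fin N) (Fin N) ℝ) (hV : V * Vᵀ = 1) (j : Fin N) :
    ∑ i, X i j ^ 2 = ∑ i, (Vᵀ * X) i j ^ 2 := by
  have h1 : ∀ Y : Matrix (Fin N) (Fin N) ℝ, ∑ i, Y i j ^ 2 = (Yᵀ * Y) j j := by
    intro Y; rw [mul_apply]
    exact Finset.sum_congr rfl fun i _ => by rw [transpose_apply, sq]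
  rw [h1, h1, transpose_mul, transpose_transpose, Matrix.mul_assoc, ← Matrix.mul_assoc V Vᵀ X, hV,
    Matrix.one_mul]

lemma rank_of_const_ker {N : ℕ} (C : Matrix (Fin N) (Fin N) ℝ) (S : Finset (Fin N))
    (hS : S.Nonempty) (h0 : ∀ i, ∀ s ∉ S, C i s = 0) (h1 : ∀ i, ∑ s ∈ S, C i s = 0) :
    C.rank ≤ S.card - 1 := by
  classical
  obtain ⟨s0, hs0⟩ := hS
  set E : Matrix (Fin N) (Fin N) ℝ := diagonal fun i => if i ∈ S.erase s0 then 1 else 0 with hE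
  set R : Matrix (Fin N) (Fin N) ℝ := fun t s => (if t = s then 1 else 0) - (if s = s0 then 1 else 0)
    with hR
  have hEr : E.rank = S.card - 1 := by
    rw [hE, rank_diagonal, Fintype.card_subtype, ← Finset.card_erase_of_mem hs0]
    congr 1; ext i; simp
  have hC : C = C * E * R := by
    ext i s
    rw [mul_apply]
    have e : ∀ t, (C * E) i t * R t s = if t ∈ S.erase s0 then C i t * R t s else 0 := by
      intro t; rw [hE, mul_diagonal]; split_ifs <;> simp
    rw [Finset.sum_congr rfl fun t _ => e t, ← Finset.sum_filter]
    have hf : Finset.univ.filter (fun t => t ∈ S.erase s0) = S.erase s0 := by ext; simp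
    rw [hf]
    have h2 := h1 i
    rw [← Finset.add_sum_erase S _ hs0] at h2
    by_cases hs : s = s0
    · subst hs
      have : ∑ t ∈ S.erase s, C i t * R t s = ∑ t ∈ S.erase s, - C i t := by
        refine Finset.sum_congr rfl fun t ht => ?_
        have : t ≠ s := Finset.ne_of_mem_erase ht
        simp [hR, this]
      rw [this, Finset.sum_neg_distrib]; linarith
    · have : ∑ t ∈ S.erase s0, C i t * R t s = ∑ t ∈ S.erase s0, if t = s then C i t else 0 := by
        refine Finset.sum_congr rfl fun t ht => ?_
        simp [hR, hs]
      rw [this, Finset.sum_ite_eq']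
      by_cases hsS : s ∈ S
      · rw [if_pos (Finset.mem_erase.2 ⟨hs, hsS⟩)]
      · rw [if_neg (fun h => hsS (Finset.mem_of_mem_erase h)), h0 i s hsS]
  rw [hC, ← hEr]
  exact (rank_mul_le_left _ _).trans (rank_mul_le_right _ _)

/-- Paper's Lemma (`unif_ub_xi_1_GLR`): for any nonempty sample set `S` of size `m` and any
`μ > 0`, the GLR squared bias satisfies `ξ₁(S) ≤ (k − 1) + ξ₂ᵇˡ(S)`, and consequently
(combining with Lemma 3) `ξ₁(S) ≤ k + B_k(m)`. -/
theorem stmt_14 (N k : ℕ) (hN : 2 ≤ N) (hk2 : 2 ≤ k) (hkN : k ≤ N)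
    (G : SimpleGraph (Fin N)) [DecidableRel G.Adj] (hG : G.Connected)
    (lam : Fin N → ℝ) (hmono : StrictMono lam) (hlam0 : lam ⟨0, by omega⟩ = 0)
    (u : Fin N → Fin N → ℝ)
    (hortho : ∀ i j, u i ⬝ᵥ u j = if i = j then (1 : ℝ) else 0)
    (heig : ∀ i, (G.lapMatrix ℝ).mulVec (u i) = lam i • u i)
    (μ : ℝ) (hμ : 0 < μ)
    (S : Finset (Fin N)) (hS : S.Nonempty) :
    let L := G.lapMatrix ℝ
    let UK : Matrix (Fin N) (Fin k) ℝ := Matrix.of fun i j => u (Fin.castLE hkN j) i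
    let P : Matrix (Fin N) (Fin N) ℝ := Matrix.diagonal fun j => if j ∈ S then 1 else 0
    let m := S.card
    let xi1 := frobSq (UK - (P + μ • L)⁻¹ * P * UK)
    let xi2bl := frobSq ((P + μ • L)⁻¹ * P * UK)
    xi1 ≤ ((k : ℝ) - 1) + xi2bl ∧ xi1 ≤ (k : ℝ) + Bbl lam k m := by
  intro L UK P m xi1 xi2bl
  classical
  set z : Fin N := ⟨0, by omega⟩ with hzdef
  have hpos : ∀ i : Fin N, i ≠ z → 0 < lam i := by
    intro i hi
    rw [← hlam0]
    refine hmono ?_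
    rw [Fin.lt_def]
    have : i.val ≠ 0 := fun h => hi (Fin.ext h)
    simp [hzdef]; omega
  have hnn : ∀ i, 0 ≤ lam i := by
    intro i
    by_cases h : i = z
    · rw [h, hlam0]
    · exact (hpos i h).le
  have hLt : Lᵀ = L := G.isSymm_lapMatrix ℝ
  have hPt : Pᵀ = P := diagonal_transpose _
  have hPP : P * P = P := by
    show diagonal _ * diagonal _ = diagonal _
    rw [diagonal_mul_diagonal]; congr 1; ext i; split_ifs <;> simp
  set A := P + μ • L with hA
  have hAt : Aᵀ = A := by rw [hA, transpose_add, transpose_smul, hLt, hPt]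
  -- invertibility
  have hker : ∀ x, A *ᵥ x = 0 → x = 0 := by
    intro x hx
    have h1 : x ⬝ᵥ (P *ᵥ x) + μ * (x ⬝ᵥ (L *ᵥ x)) = 0 := by
      have : x ⬝ᵥ (A *ᵥ x) = 0 := by rw [hx, dotProduct_zero]
      rwa [hA, add_mulVec, dotProduct_add, smul_mulVec, dotProduct_smul, smul_eq_mul] at this
    have h2 : 0 ≤ x ⬝ᵥ (L *ᵥ x) := by
      simpa using (G.posSemidef_lapMatrix ℝ).dotProduct_mulVec_nonneg x
    have h3 : x ⬝ᵥ (P *ᵥ x) = ∑ i, if i ∈ S then x i ^ 2 else 0 := by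
      simp only [dotProduct, P, mulVec_diagonal]
      refine Finset.sum_congr rfl fun i _ => ?_
      split_ifs <;> ring
    have h4 : ∀ i ∈ Finset.univ, 0 ≤ (if i ∈ S then x i ^ 2 else 0) := by
      intro i _; split_ifs <;> positivity
    have h5 : x ⬝ᵥ (L *ᵥ x) = 0 := by
      have := Finset.sum_nonneg h4
      rw [← h3] at this
      nlinarith [mul_nonneg hμ.le h2]
    have h6 : ∑ i, (if i ∈ S then x i ^ 2 else 0) = 0 := by
      rw [h5] at h1; rw [← h3]; linarith
    rw [Finset.sum_eq_zero_iff_of_nonneg h4] at h6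
    have h7 := (G.lapMatrix_toLinearMap₂'_apply'_eq_zero_iff_forall_reachable x).1
      (by rw [toLinearMap₂'_apply']; exact h5)
    obtain ⟨s, hs⟩ := hS
    have h8 : x s = 0 := by
      have := h6 s (Finset.mem_univ _)
      rw [if_pos hs] at this
      exact pow_eq_zero_iff (two_ne_zero) |>.1 this
    ext i
    rw [h7 i s (hG.preconnected i s), h8]; rfl
  have hdet : IsUnit A.det := by
    rw [isUnit_iff_ne_zero]
    intro h
    obtain ⟨x, hx0, hx⟩ := exists_mulVec_eq_zero_iff.2 h
    exact hx0 (hker x hx)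
  set B := A⁻¹ with hB
  have hAB : A * B = 1 := mul_nonsing_inv _ hdet
  have hBA : B * A = 1 := nonsing_inv_mul _ hdet
  have hBt : Bᵀ = B := by rw [hB, transpose_nonsing_inv, hAt]
  set V : Matrix (Fin N) (Fin N) ℝ := Matrix.of fun i j => u j i with hV
  have hVV : Vᵀ * V = 1 := by
    ext i j
    rw [mul_apply, one_apply, ← hortho i j]; rfl
  have hVV' : V * Vᵀ = 1 := mul_eq_one_comm.1 hVV
  have hLV : L * V = V * diagonal lam := by
    ext i j
    have := congrFun (heig j) i
    rw [mul_diagonal, mul_apply]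
    simp only [mulVec, dotProduct, Pi.smul_apply, smul_eq_mul] at this
    rw [mul_comm]; exact this
  set Λ : Matrix (Fin N) (Fin N) ℝ := diagonal lam with hΛ
  set M := Vᵀ * B * V with hM
  set Q := Vᵀ * P * V with hQ
  have hMt : Mᵀ = M := by
    rw [hM, transpose_mul, transpose_mul, transpose_transpose, hBt, Matrix.mul_assoc]
  have hQt : Qᵀ = Q := by
    rw [hQ, transpose_mul, transpose_mul, transpose_transpose, hPt, Matrix.mul_assoc]
  have hcanc : ∀ X Y : Matrix (Fin N) (Fin N) ℝ, X * V * (Vᵀ * Y) = X * Y := by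
    intro X Y
    rw [Matrix.mul_assoc, ← Matrix.mul_assoc V, hVV', Matrix.one_mul]
  have hQQ : Q * Q = Q := by
    calc Q * Q = Vᵀ * P * V * (Vᵀ * (P * V)) := by rw [hQ]; simp only [Matrix.mul_assoc]
      _ = Vᵀ * P * (P * V) := hcanc _ _
      _ = Vᵀ * (P * P) * V := by simp only [Matrix.mul_assoc]
      _ = Q := by rw [hPP]
  have hVL : Vᵀ * L = Λ * Vᵀ := by
    have := congrArg transpose hLV
    rwa [transpose_mul, transpose_mul, hLt, hΛ, diagonal_transpose] at this
  have hPB : P * B = 1 - μ • (L * B) := by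
    rw [eq_sub_iff_add_eq, ← hAB, hA, Matrix.add_mul, Matrix.smul_mul]
  have hQM : Q * M = 1 - μ • (Λ * M) := by
    have : Q * M = Vᵀ * (P * B) * V := by
      rw [hQ, hM, Matrix.mul_assoc Vᵀ B V, hcanc]
      simp only [Matrix.mul_assoc]
    rw [this, hPB, Matrix.mul_sub, Matrix.sub_mul, Matrix.mul_one, hVV, Matrix.mul_smul,
      Matrix.smul_mul, ← Matrix.mul_assoc Vᵀ L B, hVL, hM]
    simp only [Matrix.mul_assoc]
  have hMQ : M * Q = 1 - μ • (M * Λ) := by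
    have := congrArg transpose hQM
    rwa [transpose_mul Q M, transpose_sub, transpose_smul, transpose_mul Λ M, hMt, hQt,
      transpose_one, hΛ, diagonal_transpose] at this
  have hHV : Vᵀ * (B * P * V) = M * Q := by
    rw [hQ, hM, Matrix.mul_assoc Vᵀ P V, hcanc]
    simp only [Matrix.mul_assoc]
  have hent : ∀ i j, (M * Q) i j = (if i = j then 1 else 0) - μ * (M i j * lam j) := by
    intro i j
    rw [hMQ, Matrix.sub_apply, Matrix.smul_apply, hΛ, mul_diagonal, one_apply, smul_eq_mul]
  -- the constant eigenvector
  have hconst : ∀ i j, u z i = u z j := by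
    have h0 : L *ᵥ (u z) = 0 := by rw [heig z, hlam0, zero_smul]
    intro i j
    exact (G.lapMatrix_mulVec_eq_zero_iff_forall_reachable).1 h0 i j (hG.preconnected i j)
  have hNc : (N : ℝ) * u z z ^ 2 = 1 := by
    have := hortho z z
    rw [if_pos rfl, dotProduct] at this
    rw [← this, Finset.sum_congr rfl fun i _ => by rw [hconst i z]]
    simp [sq]
  have hm0 : 0 < m := Finset.card_pos.2 hS
  have hmN : m ≤ N := by simpa using Finset.card_le_univ S
  have hmR : (0 : ℝ) < m := by exact_mod_cast hm0
  have hQzz : ((N : ℝ) / m) * Q z z = 1 := by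
    have : Q z z = m * u z z ^ 2 := by
      rw [hQ, mul_apply]
      have e : ∀ j, (Vᵀ * P) z j * V j z = if j ∈ S then u z z ^ 2 else 0 := by
        intro j
        simp only [P, mul_diagonal, transpose_apply, hV, of_apply]
        rw [hconst j z]
        split_ifs <;> ring
      rw [Finset.sum_congr rfl fun j _ => e j, ← Finset.sum_filter]
      simp [m]
    rw [this, ← hNc]; field_simp
  -- the matrix T
  set D : Matrix (Fin N) (Fin N) ℝ := diagonal (fun i => Real.sqrt (lam i)) with hD
  obtain ⟨T, hTdef⟩ : ∃ T, T = diagonal (fun i => if i = z then (0 : ℝ) else 1) -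
      μ • (D * M * D) := ⟨_, rfl⟩
  obtain ⟨hTt, hTT⟩ := tmat_key lam hnn z hlam0 μ hμ Q M hQt hMt hQQ hQM T hTdef
  have hTe : ∀ i j, T i j = (if i = j then (if i = z then 0 else 1) else 0) -
      μ * (Real.sqrt (lam i) * M i j * Real.sqrt (lam j)) := by
    intro i j
    rw [hTdef, Matrix.sub_apply, Matrix.smul_apply, hD, mul_diagonal, diagonal_mul, smul_eq_mul,
      diagonal_apply]
  have hT0 : ∀ j, T z j = 0 := by
    intro j; rw [hTe, hlam0]; simp
  have hTr : T.rank ≤ m - 1 := by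
    set C := D * Vᵀ * B * P with hC
    have hTC : T = C * (V * diagonal (fun i => (Real.sqrt (lam i))⁻¹)) := by
      have e : C * (V * diagonal (fun i => (Real.sqrt (lam i))⁻¹)) =
          D * (M * Q) * diagonal (fun i => (Real.sqrt (lam i))⁻¹) := by
        rw [hC, ← hHV]; simp only [Matrix.mul_assoc]
      rw [e]
      ext i j
      rw [mul_diagonal, hD, diagonal_mul, hent, hTe]
      by_cases hj : j = z
      · rw [hj, hlam0]
        by_cases hi : i = z
        · simp [hi]
        · simp [hi]
      · have hl := hpos j hj
        have hs : 0 < Real.sqrt (lam j) := Real.sqrt_pos.2 hl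
        have hss : Real.sqrt (lam j) * Real.sqrt (lam j) = lam j := Real.mul_self_sqrt hl.le
        have e2 : lam j * (Real.sqrt (lam j))⁻¹ = Real.sqrt (lam j) := by
          rw [← hss]; simp
        by_cases hij : i = j
        · subst hij
          rw [if_pos rfl, if_neg hj, if_pos rfl, mul_sub, sub_mul, mul_one, mul_inv_cancel₀ hs.ne']
          congr 1
          calc μ * (√(lam i) * M i i * √(lam i))
              = μ * (√(lam i) * M i i * (lam i * (√(lam i))⁻¹)) := by rw [e2]
            _ = _ := by ring
        · rw [if_neg hij, if_neg hij]
          calc 0 - μ * (√(lam i) * M i j * √(lam j))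
              = 0 - μ * (√(lam i) * M i j * (lam j * (√(lam j))⁻¹)) := by rw [e2]
            _ = _ := by ring
    have hCr : C.rank ≤ S.card - 1 := by
      refine rank_of_const_ker C S hS ?_ ?_
      · intro i s hs
        rw [hC]; simp only [P, mul_diagonal]; simp [hs]
      · intro i
        have h1 : C * V = D * (M * Q) := by rw [hC, ← hHV]; simp only [Matrix.mul_assoc]
        have h2 : (C * V) i z = 0 := by
          rw [h1, hD, diagonal_mul, hent, hlam0]
          by_cases hi : i = z
          · rw [hi, hlam0]; simp
          · simp [hi]
        have h3 : (C * V) i z = u z z * ∑ s ∈ S, C i s := by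
          rw [mul_apply, Finset.mul_sum]
          symm
          rw [Finset.sum_subset (Finset.subset_univ S)]
          · refine Finset.sum_congr rfl fun s _ => ?_
            simp only [hV, of_apply]
            rw [hconst s z]; ring
          · intro s _ hs
            rw [hC]; simp only [P, mul_diagonal]; simp [hs]
        rw [h3] at h2
        refine (mul_eq_zero.1 h2).resolve_left ?_
        intro h; rw [h] at hNc; simp at hNc
    rw [hTC]
    exact (rank_mul_le_left _ _).trans hCr
  -- Frobenius norms in the eigenbasis
  set K : Finset (Fin N) := Finset.univ.filter (fun j : Fin N => j.val < k) with hK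
  have hKcard : (K.card : ℝ) = k := by
    have := sum_castLE hkN (fun _ => (1 : ℝ))
    simp at this
    rw [hK]; exact_mod_cast this.symm
  have hUV : ∀ X : Matrix (Fin N) (Fin N) ℝ, ∀ i (j : Fin k),
      (X * UK) i j = (X * V) i (Fin.castLE hkN j) := by
    intro X i j; rw [mul_apply, mul_apply]; rfl
  have hxi2 : xi2bl = ∑ j ∈ K, ∑ i, (M * Q) i j ^ 2 := by
    show frobSq (B * P * UK) = _
    rw [frobSq_eq]
    simp only [hUV]
    rw [sum_castLE hkN (fun j => ∑ i, (B * P * V) i j ^ 2)]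
    refine Finset.sum_congr rfl fun j _ => ?_
    rw [colsum_orth V _ hVV', hHV]
  have hxi1 : xi1 = ∑ j ∈ K, ∑ i, ((1 : Matrix (Fin N) (Fin N) ℝ) - M * Q) i j ^ 2 := by
    show frobSq (UK - B * P * UK) = _
    have e : UK - B * P * UK = (1 - B * P) * UK := by rw [Matrix.sub_mul, Matrix.one_mul]
    rw [e, frobSq_eq]
    simp only [hUV]
    rw [sum_castLE hkN (fun j => ∑ i, ((1 - B * P) * V) i j ^ 2)]
    refine Finset.sum_congr rfl fun j _ => ?_
    rw [colsum_orth V _ hVV', Matrix.sub_mul, Matrix.one_mul, Matrix.mul_sub, hHV, hVV]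
  have hrel : xi1 = k - 2 * ∑ j ∈ K, (M * Q) j j + xi2bl := by
    rw [hxi1, hxi2, ← hKcard, Finset.mul_sum, Finset.card_eq_sum_ones, Nat.cast_sum,
      ← Finset.sum_sub_distrib, ← Finset.sum_add_distrib]
    refine Finset.sum_congr rfl fun j _ => ?_
    have e : ∀ i, ((1 : Matrix (Fin N) (Fin N) ℝ) - M * Q) i j ^ 2 =
        (if i = j then 1 - 2 * (M * Q) j j else 0) + (M * Q) i j ^ 2 := by
      intro i
      rw [Matrix.sub_apply, one_apply]
      split_ifs with h
      · rw [h]; ring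
      · ring
    rw [Finset.sum_congr rfl fun i _ => e i, Finset.sum_add_distrib]
    simp
  have hzK : z ∈ K := by simp [hK, hzdef]; omega
  have htr : 1 ≤ ∑ j ∈ K, (M * Q) j j := by
    have hzz : (M * Q) z z = 1 := by rw [hent, hlam0]; simp
    rw [← hzz]
    refine Finset.single_le_sum (f := fun j => (M * Q) j j) (fun j _ => ?_) hzK
    by_cases hj : j = z
    · rw [hj, hzz]; norm_num
    · have h1 : (M * Q) j j = T j j := by
        rw [hent, hTe, if_pos rfl, if_pos rfl, if_neg hj]
        have hss : Real.sqrt (lam j) * Real.sqrt (lam j) = lam j := Real.mul_self_sqrt (hnn j)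
        linear_combination (μ * M j j) * hss
      show 0 ≤ (M * Q) j j
      rw [h1]
      exact le_trans (Finset.sum_nonneg fun _ _ => sq_nonneg _) (hTT j)
  have part1 : xi1 ≤ ((k : ℝ) - 1) + xi2bl := by rw [hrel]; linarith
  refine ⟨part1, ?_⟩
  suffices hB : xi2bl ≤ Bbl lam k m by linarith
  have ha : eig1 lam 2 = lam ⟨1, by omega⟩ := eig1_val lam ⟨1, by omega⟩
  have hb : eig1 lam k = lam ⟨k - 1, by omega⟩ := by
    have := eig1_val lam ⟨k - 1, by omega⟩
    simp only at this
    rwa [show k - 1 + 1 = k by omega] at this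
  have hrow : ∑ j ∈ K, (Q * M) j z ^ 2 ≤ omegaFn (eig1 lam k / eig1 lam 2) * ((N : ℝ) / m) := by
    rw [ha, hb]
    refine first_row_bound lam z hlam0 hpos μ hμ Q M hQt hQQ hQM _ hQzz K _ _ ?_ ?_ ?_ ?_
    · refine hpos _ ?_
      intro h; simp [hzdef] at h
    · exact hmono.monotone (Fin.le_def.2 (by simp; omega))
    · intro j hj hjz
      have h1 : j.val ≠ 0 := fun h => hjz (Fin.ext h)
      simp only [hK, Finset.mem_filter, Finset.mem_univ, true_and] at hj
      exact ⟨hmono.monotone (Fin.le_def.2 (by simp; omega)),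
        hmono.monotone (Fin.le_def.2 (by simp; omega))⟩
    · intro j hj hjz
      simp only [hK, Finset.mem_filter, Finset.mem_univ, true_and] at hj
      exact hmono.monotone (Fin.le_def.2 (by simp; omega))
  have hband := band_bound (r := m - 1) hk2 hkN (by omega) lam hmono hlam0 T hTt hTT hTr hT0
  rw [show m - 1 + 1 = m by omega] at hband
  have hsplit : xi2bl = ∑ j ∈ K, (Q * M) j z ^ 2 +
      ∑ i, ∑ j, (if j.val < k then lam j * (lam i)⁻¹ * T i j ^ 2 else 0) := by
    rw [Finset.sum_comm (f := fun (i j : Fin N) =>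
      if j.val < k then lam j * (lam i)⁻¹ * T i j ^ 2 else 0)]
    have e : ∀ j : Fin N, ∑ i, (if j.val < k then lam j * (lam i)⁻¹ * T i j ^ 2 else 0) =
        if j.val < k then ∑ i, lam j * (lam i)⁻¹ * T i j ^ 2 else 0 := by
      intro j; split_ifs <;> simp
    rw [Finset.sum_congr rfl fun j _ => e j, ← Finset.sum_filter, hxi2, ← Finset.sum_add_distrib]
    refine Finset.sum_congr rfl fun j _ => ?_
    have e1 : ∀ i, (M * Q) i j ^ 2 = (if i = z then (M * Q) z j ^ 2 else 0) +
        lam j * (lam i)⁻¹ * T i j ^ 2 := by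
      intro i
      by_cases hi : i = z
      · rw [if_pos hi, hi, hlam0]; simp
      · rw [if_neg hi, zero_add]
        have hl := hpos i hi
        have hsi : Real.sqrt (lam i) ^ 2 = lam i := Real.sq_sqrt hl.le
        have hsj : Real.sqrt (lam j) ^ 2 = lam j := Real.sq_sqrt (hnn j)
        have hrel : Real.sqrt (lam i) * (M * Q) i j = Real.sqrt (lam j) * T i j := by
          rw [hent, hTe]
          by_cases hij : i = j
          · subst hij
            rw [if_pos rfl, if_pos rfl, if_neg hi]
            linear_combination (μ * M i i * √(lam i)) * hsi
          · rw [if_neg hij, if_neg hij]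
            linear_combination (μ * M i j * √(lam i)) * hsj
        have h2 : lam i * (M * Q) i j ^ 2 = lam j * T i j ^ 2 := by
          rw [← hsi, ← hsj, ← mul_pow, ← mul_pow, hrel]
        field_simp
        linarith
    rw [Finset.sum_congr rfl fun i _ => e1 i, Finset.sum_add_distrib]
    congr 1
    rw [Finset.sum_ite_eq' Finset.univ z, if_pos (Finset.mem_univ _)]
    have : (M * Q) z j = (Q * M) j z := by
      rw [← transpose_apply (M * Q) j z, transpose_mul, hMt, hQt]
    rw [this]
  rw [hsplit, Bbl]
  exact add_le_add hrow hband
end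

section
/- Assume k ≥ 2, let S be a nonempty finite subset of Fin N with |S| = m, and let σ : ℝ. Then ξ₁(S) + σ²·ξ₂(S) ≤ (k + B_k(m)) + σ²·B(m). That is, the average MSE of GLR reconstruction from any sample set of size m is bounded above by a quantity depending only on the Laplacian spectrum, k, m, and σ², uniformly in μ and in the choice of S. -/
open Matrix

/-- `B(m) = r·(N/m) + ∑_{i=2}^{m} ω(max(1, λ_{N+2−i}/λᵢ))` where `r = ω(λ_N/λ₂)`. -/
noncomputable def Bfull {N : ℕ} (lam : Fin N → ℝ) (m : ℕ) : ℝ :=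
  omegaFn (eig1 lam N / eig1 lam 2) * ((N : ℝ) / (m : ℝ)) +
    ∑ i ∈ Finset.Icc 2 m, omegaFn (max 1 (eig1 lam (N + 2 - i) / eig1 lam i))

open Finset
namespace Kant

noncomputable def phi (x y : ℝ) : ℝ := y / x + x / y - 2

noncomputable def psi (f : ℕ → ℝ) (a b : ℕ) : ℝ :=
  if a = b then phi (f a) (f (a+1)) else
  phi (f a) (f (b+1)) - phi (f (a+1)) (f (b+1)) - phi (f a) (f b) + phi (f (a+1)) (f b)

lemma phi_self {x : ℝ} (hx : 0 < x) : phi x x = 0 := by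
  unfold phi; field_simp; ring

lemma phi_nonneg {x y : ℝ} (hx : 0 < x) (hy : 0 < y) : 0 ≤ phi x y := by
  have : phi x y = (x - y)^2 / (x * y) := by unfold phi; field_simp; ring
  rw [this]; positivity

lemma psi_nonneg (f : ℕ → ℝ) (a b : ℕ) (h1 : 0 < f a) (h2 : 0 < f (a+1)) (h3 : 0 < f b)
    (h4 : 0 < f (b+1)) (ha : f a ≤ f (a+1)) (hb : f b ≤ f (b+1)) : 0 ≤ psi f a b := by
  unfold psi
  split_ifs with h
  · exact phi_nonneg h1 h2
  · have e : phi (f a) (f (b+1)) - phi (f (a+1)) (f (b+1)) - phi (f a) (f b) + phi (f (a+1)) (f b)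
      = (f (b+1) - f b) * ((f (a+1) - f a) / (f a * f (a+1)))
        + (f (a+1) - f a) * ((f (b+1) - f b) / (f b * f (b+1))) := by
      unfold phi; field_simp; ring
    rw [e]
    have := sub_nonneg.2 ha
    have := sub_nonneg.2 hb
    positivity

lemma psi_inner (f : ℕ → ℝ) (a j : ℕ) (haj : a + 1 ≤ j) (h0 : 0 < f (a+1)) :
    ∑ b ∈ Ico a j, psi f a b = phi (f a) (f j) - phi (f (a+1)) (f j) := by
  induction j, haj using Nat.le_induction with
  | base => simp [psi, phi_self h0]
  | succ j hj ih =>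
    rw [sum_Ico_succ_top (by omega), ih]
    have : a ≠ j := by omega
    simp only [psi, this, if_false]; ring

lemma psi_sum (f : ℕ → ℝ) (i j : ℕ) (hij : i ≤ j) (h0 : ∀ a, i ≤ a → a ≤ j → 0 < f a) :
    ∑ a ∈ Ico i j, ∑ b ∈ Ico a j, psi f a b = phi (f i) (f j) := by
  have : ∑ a ∈ Ico i j, ∑ b ∈ Ico a j, psi f a b
      = ∑ a ∈ Ico i j, (phi (f a) (f j) - phi (f (a+1)) (f j)) := by
    apply sum_congr rfl
    intro a ha
    rw [mem_Ico] at ha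
    exact psi_inner f a j (by omega) (h0 _ (by omega) (by omega))
  rw [this]
  have h := Finset.sum_Ico_sub (fun a => - phi (f a) (f j)) hij
  rw [phi_self (h0 j hij le_rfl)] at h
  simp only [sub_neg_eq_add, neg_zero, zero_add] at h
  rw [← h]
  apply sum_congr rfl; intros; ring

lemma psi_sum_ite (k : ℕ) (f : ℕ → ℝ) (i j : ℕ) (hi : 1 ≤ i) (hj : j < k)
    (h0 : ∀ a, 1 ≤ a → a < k → 0 < f a) :
    ∑ a ∈ Ico 1 k, ∑ b ∈ Ico 1 k, (if i ≤ a ∧ a ≤ b ∧ b < j then psi f a b else 0) =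
      if i < j then phi (f i) (f j) else 0 := by
  split_ifs with hij
  · rw [← psi_sum f i j hij.le (fun a h1 h2 => h0 a (by omega) (by omega))]
    have hs : Ico i j ⊆ Ico 1 k := Ico_subset_Ico hi hj.le
    rw [← sum_subset hs]
    · apply sum_congr rfl
      intro a ha
      rw [mem_Ico] at ha
      have hs : Ico a j ⊆ Ico 1 k := Ico_subset_Ico (by omega) hj.le
      rw [← sum_subset hs]
      · apply sum_congr rfl
        intro b hb
        rw [mem_Ico] at hb
        rw [if_pos (by omega)]
      · intro b _ hb
        rw [mem_Ico] at hb
        rw [if_neg (by omega)]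
    · intro a _ ha
      rw [mem_Ico] at ha
      apply sum_eq_zero
      intro b _
      rw [if_neg (by omega)]
  · apply sum_eq_zero
    intro a _
    apply sum_eq_zero
    intro b _
    rw [if_neg (by omega)]

lemma lp (k p : ℕ) (f : ℕ → ℝ) (h0 : ∀ a, 1 ≤ a → a < k → 0 < f a)
    (hm : ∀ a, 1 ≤ a → a + 1 < k → f a ≤ f (a+1)) (w : ℕ → ℕ → ℝ)
    (hb : ∀ a b, 1 ≤ a → a ≤ b → b + 1 < k →
      ∑ i ∈ Ico 1 (a+1), ∑ j ∈ Ico (b+1) k, w i j ≤ ((min p (min a (k-1-b)) : ℕ) : ℝ) / 4) :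
    ∑ i ∈ Ico 1 k, ∑ j ∈ Ico 1 k, (if i < j then w i j * phi (f i) (f j) else 0) ≤
      ∑ l ∈ Ico 1 (p+1), (if l < k - l then phi (f l) (f (k-l)) / 4 else 0) := by
  have hL : ∑ i ∈ Ico 1 k, ∑ j ∈ Ico 1 k, (if i < j then w i j * phi (f i) (f j) else 0) =
      ∑ a ∈ Ico 1 k, ∑ b ∈ Ico 1 k, ∑ i ∈ Ico 1 k, ∑ j ∈ Ico 1 k,
        (if i ≤ a ∧ a ≤ b ∧ b < j then w i j * psi f a b else 0) := by
    have : ∀ i ∈ Ico 1 k, ∀ j ∈ Ico 1 k, (if i < j then w i j * phi (f i) (f j) else 0) =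
        ∑ a ∈ Ico 1 k, ∑ b ∈ Ico 1 k, 
          (if i ≤ a ∧ a ≤ b ∧ b < j then w i j * psi f a b else 0) := by
      intro i hi j hj
      rw [mem_Ico] at hi hj
      have := congrArg (fun t => w i j * t) (psi_sum_ite k f i j hi.1 hj.2 h0)
      simp only [mul_sum, mul_ite, mul_zero] at this
      exact this.symm
    rw [sum_congr rfl (fun i hi => sum_congr rfl (fun j hj => this i hi j hj))]
    rw [sum_congr rfl (fun i hi => sum_comm), sum_comm]
    apply sum_congr rfl; intro a _
    rw [sum_congr rfl (fun i hi => sum_comm), sum_comm]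
  have hR : ∑ l ∈ Ico 1 (p+1), (if l < k - l then phi (f l) (f (k-l)) / 4 else 0) =
      ∑ a ∈ Ico 1 k, ∑ b ∈ Ico 1 k, ∑ l ∈ Ico 1 (p+1),
        (if l ≤ a ∧ a ≤ b ∧ b < k - l then psi f a b / 4 else 0) := by
    have : ∀ l ∈ Ico 1 (p+1), (if l < k - l then phi (f l) (f (k-l)) / 4 else 0) =
        ∑ a ∈ Ico 1 k, ∑ b ∈ Ico 1 k,
          (if l ≤ a ∧ a ≤ b ∧ b < k - l then psi f a b / 4 else 0) := by
      intro l hl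
      rw [mem_Ico] at hl
      by_cases hk : k = 0
      · subst hk; simp
      have := congrArg (fun t => t / 4) (psi_sum_ite k f l (k-l) hl.1 (by omega) h0)
      simp only [sum_div, ite_div, zero_div] at this
      exact this.symm
    rw [sum_congr rfl this, sum_comm]
    apply sum_congr rfl; intro a _
    rw [sum_comm]
  rw [hL, hR]
  apply sum_le_sum; intro a ha
  apply sum_le_sum; intro b hb'
  rw [mem_Ico] at ha hb'
  by_cases hab : a ≤ b ∧ b + 1 < k
  · have hp : 0 ≤ psi f a b := psi_nonneg f a b (h0 _ (by omega) (by omega))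
      (h0 _ (by omega) (by omega)) (h0 _ (by omega) (by omega)) (h0 _ (by omega) (by omega))
      (hm _ (by omega) (by omega)) (hm _ (by omega) (by omega))
    have e1 : ∑ i ∈ Ico 1 k, ∑ j ∈ Ico 1 k,
        (if i ≤ a ∧ a ≤ b ∧ b < j then w i j * psi f a b else 0) =
        (∑ i ∈ Ico 1 (a+1), ∑ j ∈ Ico (b+1) k, w i j) * psi f a b := by
      rw [sum_mul]
      rw [← sum_subset (Ico_subset_Ico le_rfl (by omega) : Ico 1 (a+1) ⊆ Ico 1 k)]
      · apply sum_congr rfl; intro i hi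
        rw [mem_Ico] at hi
        rw [sum_mul, ← sum_subset (Ico_subset_Ico (by omega) le_rfl : Ico (b+1) k ⊆ Ico 1 k)]
        · apply sum_congr rfl; intro j hj
          rw [mem_Ico] at hj
          rw [if_pos (by omega)]
        · intro j hj1 hj
          rw [mem_Ico] at hj hj1
          rw [if_neg (by omega)]
      · intro i hi1 hi
        rw [mem_Ico] at hi hi1
        apply sum_eq_zero; intro j _
        rw [if_neg (by omega)]
    have e2 : ∑ l ∈ Ico 1 (p+1), (if l ≤ a ∧ a ≤ b ∧ b < k - l then psi f a b / 4 else 0) =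
        ((min p (min a (k-1-b)) : ℕ) : ℝ) / 4 * psi f a b := by
      rw [← sum_filter]
      have : (Ico 1 (p+1)).filter (fun l => l ≤ a ∧ a ≤ b ∧ b < k - l)
        = Ico 1 (min p (min a (k-1-b)) + 1) := by
        ext l; simp only [mem_filter, mem_Ico]; omega
      rw [this, sum_const, Nat.card_Ico, nsmul_eq_mul]
      simp only [Nat.add_sub_cancel]
      ring
    rw [e1, e2]
    exact mul_le_mul_of_nonneg_right (hb a b ha.1 hab.1 hab.2) hp
  · apply le_of_eq
    rw [sum_eq_zero, sum_eq_zero]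
    · intro l hl
      rw [mem_Ico] at hl
      rw [if_neg (by omega)]
    · intro i hi
      apply sum_eq_zero; intro j hj
      rw [mem_Ico] at hj
      rw [if_neg (by omega)]

open Matrix

lemma rank_trace {n : Type*} [Fintype n] [DecidableEq n] (G : Matrix n n ℝ) (hG : G.IsHermitian)
    (p : ℕ) (hp : G.rank ≤ p) (t : ℝ) :
    t * G.trace - (G * G).trace ≤ p * (t^2 / 4) := by
  have h1 : G.trace = ∑ i, hG.eigenvalues i := by
    simpa using hG.trace_eq_sum_eigenvalues
  have h2 : (G * G).trace = ∑ i, (hG.eigenvalues i)^2 := by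
    have hs := hG.spectral_theorem
    rw [Unitary.conjStarAlgAut_apply] at hs
    set V := hG.eigenvectorUnitary
    set D : Matrix n n ℝ := diagonal (RCLike.ofReal ∘ hG.eigenvalues) with hD
    have hV : (star (V : Matrix n n ℝ)) * (V : Matrix n n ℝ) = 1 := by simp
    have : G * G = (V : Matrix n n ℝ) * (D * D * star (V : Matrix n n ℝ)) := by
      calc G * G = (V * D * star (V : Matrix n n ℝ)) * (V * D * star (V : Matrix n n ℝ)) := by
            rw [← hs]
        _ = V * D * (star (V : Matrix n n ℝ) * V) * D * star (V : Matrix n n ℝ) := by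
            simp only [Matrix.mul_assoc]
        _ = _ := by rw [hV]; simp only [Matrix.mul_assoc, Matrix.one_mul]
    rw [this, Matrix.trace_mul_comm, Matrix.mul_assoc, hV, Matrix.mul_one, hD,
      diagonal_mul_diagonal, trace_diagonal]
    apply sum_congr rfl; intro i _; simp [sq]
  rw [h1, h2, mul_sum, ← sum_sub_distrib]
  have h3 : ∑ i, (t * hG.eigenvalues i - (hG.eigenvalues i)^2) ≤
      ∑ i, (if hG.eigenvalues i ≠ 0 then t^2/4 else 0) := by
    apply sum_le_sum; intro i _
    split_ifs with h
    · nlinarith [sq_nonneg (t/2 - hG.eigenvalues i)]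
    · push Not at h; rw [h]; simp
  refine h3.trans ?_
  rw [← sum_filter, sum_const, nsmul_eq_mul]
  apply mul_le_mul_of_nonneg_right _ (by positivity)
  rw [hG.rank_eq_card_non_zero_eigs, Fintype.card_subtype] at hp
  exact_mod_cast hp

lemma block_bd {n : Type*} [Fintype n] [DecidableEq n] (A : Matrix n n ℝ) (hA : Aᵀ = A)
    (p : ℕ) (hp : A.rank ≤ p) (hrow : ∀ i, ∑ l, A i l ^ 2 ≤ A i i) (I J : Finset n)
    (hIJ : Disjoint I J) : ∑ i ∈ I, ∑ j ∈ J, A i j ^ 2 ≤ p / 4 := by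
  set Q : Matrix n n ℝ := diagonal (fun i => if i ∈ I then 1 else 0) with hQ
  have hGe : ∀ i j, (Q * A * Q) i j = if i ∈ I ∧ j ∈ I then A i j else 0 := by
    intro i j
    rw [hQ, Matrix.mul_diagonal, Matrix.diagonal_mul]
    by_cases h1 : i ∈ I <;> by_cases h2 : j ∈ I <;> simp [h1, h2]
  have hsym : ∀ i j, A i j = A j i := fun i j => by
    conv_lhs => rw [← hA]
    rfl
  have hG : (Q * A * Q).IsHermitian := by
    ext i j
    rw [conjTranspose_apply, hGe, hGe, hsym i j]
    simp [and_comm]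
  have hr : (Q * A * Q).rank ≤ p :=
    ((rank_mul_le_left _ _).trans (rank_mul_le_right _ _)).trans hp
  have := rank_trace _ hG p hr 1
  have t1 : (Q * A * Q).trace = ∑ i ∈ I, A i i := by
    simp only [trace, diag_apply, hGe, and_self]
    rw [← sum_filter]; simp
  have t2 : ((Q * A * Q) * (Q * A * Q)).trace = ∑ i ∈ I, ∑ j ∈ I, A i j ^ 2 := by
    simp only [trace, diag_apply, Matrix.mul_apply (M := Q * A * Q), hGe]
    have : ∀ i j, ((if i ∈ I ∧ j ∈ I then A i j else 0) * if j ∈ I ∧ i ∈ I then A j i else 0)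
      = if i ∈ I then (if j ∈ I then A i j ^2 else 0) else 0 := by
      intro i j
      by_cases h1 : i ∈ I <;> by_cases h2 : j ∈ I <;> simp [h1, h2, sq]
      left; exact hsym j i
    simp only [this]
    simp
  rw [t1, t2] at this
  have h : ∑ i ∈ I, ∑ j ∈ J, A i j ^ 2 + ∑ i ∈ I, ∑ j ∈ I, A i j ^ 2 ≤ ∑ i ∈ I, A i i := by
    rw [← sum_add_distrib]
    apply sum_le_sum; intro i _
    rw [← sum_union hIJ.symm]
    exact (sum_le_sum_of_subset_of_nonneg (subset_univ _) (fun _ _ _ => sq_nonneg _)).trans (hrow i)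
  linarith

lemma trace_bd {n : Type*} [Fintype n] [DecidableEq n] (A : Matrix n n ℝ) (hA : Aᵀ = A)
    (p : ℕ) (hp : A.rank ≤ p) (hrow : ∀ i, ∑ l, A i l ^ 2 ≤ A i i) :
    ∑ i, A i i ≤ p := by
  have hsym : ∀ i j, A i j = A j i := fun i j => by
    conv_lhs => rw [← hA]
    rfl
  have h := rank_trace A (by rw [IsHermitian, conjTranspose_eq_transpose_of_trivial, hA]) p hp 2
  have t2 : (A * A).trace = ∑ i, ∑ l, A i l ^ 2 := by
    simp only [trace, diag_apply, Matrix.mul_apply]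
    apply sum_congr rfl; intro i _; apply sum_congr rfl; intro j _; rw [hsym j i, sq]
  have t1 : A.trace = ∑ i, A i i := rfl
  have := sum_le_sum (fun i (_ : i ∈ univ) => hrow i)
  rw [t1, t2] at h
  linarith

lemma core_sum (N k p : ℕ) (hkN : k ≤ N) (f : ℕ → ℝ) (h0 : ∀ a, 1 ≤ a → a < N → 0 < f a)
    (hm : ∀ a b, a ≤ b → b < N → f a ≤ f b) (z : ℕ → ℕ → ℝ) (hsym : ∀ i j, z i j = z j i)
    (hrow : ∀ j < N, ∑ i ∈ Ico 1 N, z i j ^ 2 ≤ z j j)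
    (hblock : ∀ a b, 1 ≤ a → a ≤ b → b + 1 < k →
      ∑ i ∈ Ico 1 (a+1), ∑ j ∈ Ico (b+1) k, z i j ^ 2 ≤ (p : ℝ) / 4) :
    ∑ j ∈ Ico 1 k, ∑ i ∈ Ico 1 N, z i j ^ 2 * (f j / f i) ≤
      ∑ j ∈ Ico 1 k, z j j +
      ∑ l ∈ Ico 1 (p+1), (if l < k - l then phi (f l) (f (k-l)) / 4 else 0) := by
  have hq : ∀ i j, 1 ≤ j → j < N → 1 ≤ i → i < N → i ≠ j → ∀ s : Finset ℕ, s ⊆ Ico 1 N → j ∉ s →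
      ∑ l ∈ s, z l j ^ 2 ≤ 1/4 := by
    intro i j hj1 hjN _ _ _ s hs hjs
    have h1 : ∑ l ∈ insert j s, z l j ^ 2 ≤ z j j := by
      refine (sum_le_sum_of_subset_of_nonneg ?_ (fun _ _ _ => sq_nonneg _)).trans (hrow j hjN)
      intro l hl
      rw [mem_insert] at hl
      rcases hl with rfl | hl
      · exact mem_Ico.2 ⟨hj1, hjN⟩
      · exact hs hl
    rw [sum_insert hjs] at h1
    nlinarith [sq_nonneg (z j j - 1/2)]
  have hlp := lp k p f (fun a h1 h2 => h0 a h1 (by omega)) (fun a h1 h2 => hm _ _ (by omega) (by omega))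
    (fun i j => z i j ^ 2) (by
      intro a b ha hab hb
      have b1 := hblock a b ha hab hb
      have b2 : ∑ i ∈ Ico 1 (a+1), ∑ j ∈ Ico (b+1) k, z i j ^ 2 ≤ (a : ℝ) / 4 := by
        calc _ ≤ ∑ i ∈ Ico 1 (a+1), (1/4 : ℝ) := by
              apply sum_le_sum; intro i hi
              rw [mem_Ico] at hi
              simp only [hsym i]
              apply hq (b+1) i (by omega) (by omega) (by omega) (by omega) (by omega)
              · exact Ico_subset_Ico (by omega) (by omega)
              · rw [mem_Ico]; omega
          _ = (a : ℝ) / 4 := by simp; ring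
      have b3 : ∑ i ∈ Ico 1 (a+1), ∑ j ∈ Ico (b+1) k, z i j ^ 2 ≤ ((k-1-b : ℕ) : ℝ) / 4 := by
        rw [sum_comm]
        calc _ ≤ ∑ i ∈ Ico (b+1) k, (1/4 : ℝ) := by
              apply sum_le_sum; intro i hi
              rw [mem_Ico] at hi
              apply hq a i (by omega) (by omega) (by omega) (by omega) (by omega)
              · exact Ico_subset_Ico (by omega) (by omega)
              · rw [mem_Ico]; omega
          _ = ((k-1-b : ℕ) : ℝ) / 4 := by
              rw [sum_const, Nat.card_Ico, nsmul_eq_mul, show k - (b+1) = k-1-b by omega]; ring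
      rcases min_choice p (min a (k-1-b)) with h | h
      · rw [h]; exact b1
      · rw [h]
        rcases min_choice a (k-1-b) with h | h
        · rw [h]; exact b2
        · rw [h]; exact b3)
  have hA : ∑ i ∈ Ico 1 k, ∑ j ∈ Ico 1 k, (if i < j then z i j ^ 2 * phi (f i) (f j) else 0) =
      ∑ j ∈ Ico 1 k, ∑ i ∈ Ico 1 k, z i j ^ 2 * (f j / f i - 1) := by
    have e : ∀ i ∈ Ico 1 k, ∀ j ∈ Ico 1 k, (if i < j then z i j ^ 2 * phi (f i) (f j) else 0)
        = (if i < j then z i j ^ 2 * (f j / f i - 1) else 0) +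
          (if i < j then z j i ^ 2 * (f i / f j - 1) else 0) := by
      intro i hi j hj
      split_ifs
      · rw [hsym j i]; unfold phi; ring
      · simp
    rw [sum_congr rfl (fun i hi => sum_congr rfl (fun j hj => e i hi j hj))]
    simp only [sum_add_distrib]
    rw [sum_comm, ← sum_add_distrib]
    apply sum_congr rfl; intro j hj
    rw [← sum_add_distrib]
    apply sum_congr rfl; intro i hi
    rw [mem_Ico] at hi hj
    rcases lt_trichotomy i j with h | h | h
    · rw [if_pos h, if_neg (by omega)]; ring
    · subst h
      have := h0 i hi.1 (by omega)
      simp [this.ne']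
    · rw [if_neg (by omega), if_pos h]; ring
  have hB : ∀ j ∈ Ico 1 k, ∑ i ∈ Ico 1 N, z i j ^ 2 * (f j / f i) ≤
      z j j + ∑ i ∈ Ico 1 k, z i j ^ 2 * (f j / f i - 1) := by
    intro j hj
    rw [mem_Ico] at hj
    have := hrow j (by omega)
    have e : ∑ i ∈ Ico 1 N, z i j ^ 2 * (f j / f i) =
      ∑ i ∈ Ico 1 N, z i j ^ 2 + ∑ i ∈ Ico 1 N, z i j ^ 2 * (f j / f i - 1) := by
      rw [← sum_add_distrib]; apply sum_congr rfl; intros; ring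
    rw [e]
    rw [← sum_Ico_consecutive (fun i => z i j ^ 2 * (f j / f i - 1)) (by omega : 1 ≤ k) hkN]
    have : ∑ i ∈ Ico k N, z i j ^ 2 * (f j / f i - 1) ≤ 0 := by
      apply sum_nonpos; intro i hi
      rw [mem_Ico] at hi
      apply mul_nonpos_of_nonneg_of_nonpos (sq_nonneg _)
      have := h0 i (by omega) (by omega)
      rw [sub_nonpos, div_le_one this]
      exact hm _ _ (by omega) (by omega)
    linarith
  refine (sum_le_sum hB).trans ?_
  rw [sum_add_distrib, ← hA]
  linarith

noncomputable def om (x y : ℝ) : ℝ := (x + y)^2 / (4 * x * y)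

lemma scalar_pt (x y l s c : ℝ) (hx : 0 < x) (hl1 : x ≤ l) (hl2 : l ≤ y) :
    0 ≤ om x y * s^2 - c^2 - (x + y) * ((s - c) * c / l) := by
  have hl : 0 < l := by linarith
  have hy : 0 < y := by linarith
  have e : om x y * s^2 - c^2 - (x + y) * ((s - c) * c / l)
     = (((x+y) * l * s - 2 * x * y * c)^2 + 4 * x * y * c^2 * ((y - l) * (l - x))) / (4 * x * y * l^2) := by
    unfold om; field_simp; ring
  rw [e]
  have := mul_nonneg (sub_nonneg.2 hl2) (sub_nonneg.2 hl1)
  positivity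

lemma one_le_om (x y : ℝ) (hx : 0 < x) (hy : 0 < y) : 1 ≤ om x y := by
  unfold om
  rw [le_div_iff₀ (by positivity)]
  nlinarith [sq_nonneg (x - y)]

lemma scalar_pt2 (x y l s c : ℝ) (hx : 0 < x) (hxy : x ≤ y) (hl2 : y ≤ l) :
    0 ≤ om x y * s^2 - (x + y) * ((s - c) * c / l) := by
  have hy : 0 < y := by linarith
  have hl : 0 < l := by linarith
  have h1 := one_le_om x y hx hy
  have h2 : (x + y) / l ≤ 2 := by rw [div_le_iff₀ hl]; linarith
  have h3 : 0 ≤ (x + y) / l := by positivity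
  have e : (x + y) * ((s - c) * c / l) = (x+y)/l * ((s - c) * c) := by field_simp
  rw [e]
  have : (s - c) * c ≤ s^2 / 4 := by nlinarith [sq_nonneg (s - 2 * c)]
  have : (x+y)/l * ((s - c) * c) ≤ (x+y)/l * (s^2/4) := mul_le_mul_of_nonneg_left this h3
  nlinarith [sq_nonneg s]

lemma scalar_sum {n : Type*} [DecidableEq n] (J Kb : Finset n) (hK : Kb ⊆ J) (l s c : n → ℝ) (x y : ℝ) (hx : 0 < x)
    (hxy : x ≤ y) (h1 : ∀ j ∈ Kb, x ≤ l j ∧ l j ≤ y) (h2 : ∀ j ∈ J, j ∉ Kb → y ≤ l j)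
    (h : 0 ≤ ∑ j ∈ J, (s j - c j) * c j / l j) :
    ∑ j ∈ Kb, c j ^ 2 ≤ om x y * ∑ j ∈ J, s j ^ 2 := by
  have hp : ∀ j ∈ J, 0 ≤ om x y * s j^2 - (if j ∈ Kb then c j ^ 2 else 0)
      - (x + y) * ((s j - c j) * c j / l j) := by
    intro j hj
    split_ifs with hk
    · exact scalar_pt _ _ _ _ _ hx (h1 j hk).1 (h1 j hk).2
    · have := scalar_pt2 x y (l j) (s j) (c j) hx hxy (h2 j hj hk)
      linarith
  have := sum_nonneg hp
  rw [sum_sub_distrib, sum_sub_distrib, ← mul_sum, ← mul_sum, ← sum_filter,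
    filter_mem_eq_inter, inter_eq_right.2 hK] at this
  nlinarith [mul_nonneg (by linarith : 0 ≤ x + y) h]

lemma inv_setup {N : ℕ} (G : SimpleGraph (Fin N)) [DecidableRel G.Adj] (hG : G.Connected)
    (μ : ℝ) (hμ : 0 < μ) (S : Finset (Fin N)) (hS : S.Nonempty) :
    IsUnit (Matrix.diagonal (fun j => if j ∈ S then (1:ℝ) else 0) + μ • G.lapMatrix ℝ).det := by
  rw [isUnit_iff_ne_zero]
  intro hdet
  obtain ⟨x, hx0, hx⟩ := Matrix.exists_mulVec_eq_zero_iff.2 hdet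
  have h1 : x ⬝ᵥ ((Matrix.diagonal (fun j => if j ∈ S then (1:ℝ) else 0)) *ᵥ x)
      + μ * (x ⬝ᵥ (G.lapMatrix ℝ *ᵥ x)) = 0 := by
    have := congrArg (fun v => x ⬝ᵥ v) hx
    simpa [Matrix.add_mulVec, Matrix.smul_mulVec, dotProduct_add, dotProduct_smul] using this
  have h2 : 0 ≤ x ⬝ᵥ (G.lapMatrix ℝ *ᵥ x) := by
    have := (SimpleGraph.posSemidef_lapMatrix ℝ G).dotProduct_mulVec_nonneg x
    simpa using this
  have h3 : x ⬝ᵥ ((Matrix.diagonal (fun j => if j ∈ S then (1:ℝ) else 0)) *ᵥ x)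
      = ∑ i ∈ S, x i ^ 2 := by
    simp [dotProduct, Matrix.mulVec_diagonal, sq]
  have h4 : 0 ≤ ∑ i ∈ S, x i ^ 2 := sum_nonneg (fun _ _ => sq_nonneg _)
  rw [h3] at h1
  have h5 : x ⬝ᵥ (G.lapMatrix ℝ *ᵥ x) = 0 := by
    have := mul_nonneg hμ.le h2
    have h : μ * (x ⬝ᵥ (G.lapMatrix ℝ *ᵥ x)) = 0 := by linarith
    rcases mul_eq_zero.1 h with h | h
    · exact absurd h hμ.ne'
    · exact h
  have h6 : ∑ i ∈ S, x i ^ 2 = 0 := by rw [h5] at h1; linarith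
  have h7 := (SimpleGraph.lapMatrix_toLinearMap₂'_apply'_eq_zero_iff_forall_reachable G x).1
    (by rw [Matrix.toLinearMap₂'_apply']; exact h5)
  obtain ⟨s, hs⟩ := hS
  have h8 : x s = 0 := by
    have := (sum_eq_zero_iff_of_nonneg (fun i _ => sq_nonneg (x i))).1 h6 s hs
    exact pow_eq_zero_iff (two_ne_zero) |>.1 this
  apply hx0
  ext i
  rw [h7 i s (hG.preconnected i s), h8]; rfl

lemma frob_sum {m n : Type*} [Fintype m] [Fintype n] (A : Matrix m n ℝ) :
    frobSq A = ∑ j, ∑ i, A i j ^ 2 := by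
  simp [frobSq, Matrix.trace, Matrix.mul_apply, sq]

lemma frob_orth {N : ℕ} {n : Type*} [Fintype n] (U : Matrix (Fin N) (Fin N) ℝ) (hU : U * Uᵀ = 1)
    (A : Matrix (Fin N) n ℝ) : frobSq (Uᵀ * A) = frobSq A := by
  unfold frobSq
  rw [Matrix.transpose_mul, Matrix.transpose_transpose, Matrix.mul_assoc, ← Matrix.mul_assoc U, hU,
    Matrix.one_mul]

lemma frob_orth' {N : ℕ} (U : Matrix (Fin N) (Fin N) ℝ) (hU : U * Uᵀ = 1)
    (A : Matrix (Fin N) (Fin N) ℝ) : frobSq (A * U) = frobSq A := by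
  unfold frobSq
  rw [Matrix.transpose_mul, Matrix.trace_mul_comm, Matrix.mul_assoc, ← Matrix.mul_assoc U, hU,
    Matrix.one_mul, Matrix.trace_mul_comm]

lemma row_of_sq {n : Type*} [Fintype n] [DecidableEq n] (X Y : Matrix n n ℝ) (hX : Xᵀ = X)
    (h : X - X * X = Y * Yᵀ) (i : n) : ∑ l, X i l ^ 2 ≤ X i i := by
  have h1 := congrFun (congrFun h i) i
  have hsym : ∀ i j, X i j = X j i := fun i j => by
    conv_lhs => rw [← hX]
    rfl
  rw [Matrix.sub_apply, Matrix.mul_apply, Matrix.mul_apply] at h1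
  have h2 : ∑ l, X i l * X l i = ∑ l, X i l ^ 2 := by
    apply sum_congr rfl; intro l _; rw [hsym l i, sq]
  have h3 : 0 ≤ ∑ l, Y i l * Yᵀ l i := sum_nonneg (fun l _ => by
    rw [Matrix.transpose_apply]; exact mul_self_nonneg _)
  linarith

lemma setup {N k : ℕ} (hN : 0 < N) (hkN : k ≤ N)
    (G : SimpleGraph (Fin N)) [DecidableRel G.Adj] (hG : G.Connected)
    (lam : Fin N → ℝ) (hnn : ∀ i, 0 ≤ lam i) (hlam0 : lam ⟨0, hN⟩ = 0)
    (hpos : ∀ i, i ≠ ⟨0, hN⟩ → 0 < lam i)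
    (u : Fin N → Fin N → ℝ)
    (hortho : ∀ i j, u i ⬝ᵥ u j = if i = j then (1 : ℝ) else 0)
    (heig : ∀ i, (G.lapMatrix ℝ).mulVec (u i) = lam i • u i)
    (μ : ℝ) (hμ : 0 < μ) (S : Finset (Fin N)) (hS : S.Nonempty)
    (L UK P) (hLd : L = G.lapMatrix ℝ)
    (hUK : UK = (Matrix.of fun i j => u (Fin.castLE hkN j) i : Matrix (Fin N) (Fin k) ℝ))
    (hPd : P = (Matrix.diagonal fun j => if j ∈ S then 1 else 0 : Matrix (Fin N) (Fin N) ℝ)) :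
    ∃ (τ X A : Matrix (Fin N) (Fin N) ℝ) (s : Fin N → ℝ),
      (∀ i j, X i j = μ * √(lam i) * √(lam j) * τ i j) ∧
      (∀ i j, A i j = (if i = j ∧ i ≠ ⟨0, hN⟩ then 1 else 0) - X i j) ∧
      frobSq (UK - (P + μ • L)⁻¹ * P * UK) =
        ∑ j : Fin k, ∑ i, (μ * τ i (Fin.castLE hkN j) * lam (Fin.castLE hkN j)) ^ 2 ∧
      frobSq ((P + μ • L)⁻¹ * P) =
        ∑ j, ∑ i, ((if i = j then 1 else 0) - μ * τ i j * lam j) ^ 2 ∧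
      Xᵀ = X ∧ Aᵀ = A ∧ (∀ i, ∑ l, X i l ^ 2 ≤ X i i) ∧ (∀ i, ∑ l, A i l ^ 2 ≤ A i i) ∧
      A.rank ≤ S.card - 1 ∧
      ∑ j, s j ^ 2 = N / S.card ∧ s ⟨0, hN⟩ = 1 ∧
      0 ≤ ∑ j ∈ univ.erase ⟨0, hN⟩, (s j - (- (μ * τ ⟨0, hN⟩ j * lam j))) *
        (- (μ * τ ⟨0, hN⟩ j * lam j)) / lam j := by
  classical
  set i0 : Fin N := ⟨0, hN⟩ with hi0
  set U : Matrix (Fin N) (Fin N) ℝ := Matrix.of fun i j => u j i with hUdef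
  have hUU : Uᵀ * U = 1 := by
    ext i j
    rw [Matrix.mul_apply, Matrix.one_apply]
    exact hortho i j
  have hUU' : U * Uᵀ = 1 := mul_eq_one_comm.1 hUU
  set Lm : Matrix (Fin N) (Fin N) ℝ := Matrix.diagonal lam with hLm
  have hLU : L * U = U * Lm := by
    ext i j
    have := congrFun (heig j) i
    rw [hLm, Matrix.mul_diagonal, Matrix.mul_apply]
    simp only [Matrix.mulVec, dotProduct, Pi.smul_apply, smul_eq_mul] at this
    rw [hLd]
    simp only [hUdef, Matrix.of_apply]
    rw [this, mul_comm]
  have hLs : Lᵀ = L := by rw [hLd]; exact G.isSymm_lapMatrix (R := ℝ)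
  have hPs : Pᵀ = P := by rw [hPd]; exact Matrix.diagonal_transpose _
  have hPP : P * P = P := by
    rw [hPd, Matrix.diagonal_mul_diagonal]; congr 1; ext i; simp
  set K := P + μ • L with hK
  have hKu : IsUnit K.det := by
    rw [hK, hPd, hLd]; exact inv_setup G hG μ hμ S hS
  set T := K⁻¹ with hT
  have hTK : T * K = 1 := Matrix.nonsing_inv_mul K hKu
  have hKT : K * T = 1 := Matrix.mul_nonsing_inv K hKu
  have hKs : Kᵀ = K := by rw [hK, Matrix.transpose_add, Matrix.transpose_smul, hPs, hLs]
  have hTs : Tᵀ = T := by rw [hT, Matrix.transpose_nonsing_inv, hKs]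
  set τ := Uᵀ * T * U with hτ
  have hτs : τᵀ = τ := by
    rw [hτ]; simp only [Matrix.transpose_mul, Matrix.transpose_transpose, hTs, Matrix.mul_assoc]
  have hTP : T * P = 1 - μ • (T * L) := by
    have : P = K - μ • L := by rw [hK]; simp
    rw [this, Matrix.mul_sub, hTK, Matrix.mul_smul]
  have hMhat : Uᵀ * (T * P) * U = 1 - μ • (τ * Lm) := by
    rw [hTP, Matrix.mul_sub, Matrix.sub_mul, Matrix.mul_one, hUU, hτ, Matrix.mul_smul,
      Matrix.smul_mul]
    congr 2
    simp only [Matrix.mul_assoc, hLU]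
  have hMe : ∀ i j, (1 - μ • (τ * Lm)) i j = (if i = j then 1 else 0) - μ * τ i j * lam j := by
    intro i j
    rw [Matrix.sub_apply, Matrix.smul_apply, hLm, Matrix.mul_diagonal, Matrix.one_apply,
      smul_eq_mul]; ring
  set Sq : Matrix (Fin N) (Fin N) ℝ := Matrix.diagonal (fun i => √(lam i)) with hSq
  have hSqs : Sqᵀ = Sq := Matrix.diagonal_transpose _
  have hSqSq : Sq * Sq = Lm := by
    rw [hSq, Matrix.diagonal_mul_diagonal, hLm]; congr 1; ext i; exact Real.mul_self_sqrt (hnn i)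
  set X := μ • (Sq * τ * Sq) with hX
  have hXs : Xᵀ = X := by
    rw [hX]; simp only [Matrix.transpose_smul, Matrix.transpose_mul, hSqs, hτs, Matrix.mul_assoc]
  have hXe : ∀ i j, X i j = μ * √(lam i) * √(lam j) * τ i j := by
    intro i j
    rw [hX, Matrix.smul_apply, hSq, Matrix.mul_diagonal, Matrix.diagonal_mul, smul_eq_mul]; ring
  set Y := √μ • (Sq * (Uᵀ * (T * P))) with hY
  have hXY : X - X * X = Y * Yᵀ := by
    have e1 : X * X = (μ * μ) • (Sq * (τ * Lm * τ) * Sq) := by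
      rw [hX, Matrix.smul_mul, Matrix.mul_smul, smul_smul, ← hSqSq]
      simp only [Matrix.mul_assoc]
    have e2 : Y * Yᵀ = μ • (Sq * (Uᵀ * (T * P * T) * U) * Sq) := by
      rw [hY, Matrix.transpose_smul, Matrix.smul_mul, Matrix.mul_smul, smul_smul,
        Real.mul_self_sqrt hμ.le]
      simp only [Matrix.transpose_mul, Matrix.transpose_transpose, hTs, hPs, hSqs, Matrix.mul_assoc]
      rw [← Matrix.mul_assoc P P, hPP]
    have e3 : τ * Lm * τ = Uᵀ * (T * L * T) * U := by
      have : τ * Lm = Uᵀ * (T * L) * U := by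
        rw [hτ]; simp only [Matrix.mul_assoc, hLU]
      rw [this, hτ]
      calc Uᵀ * (T * L) * U * (Uᵀ * T * U) = Uᵀ * (T * L) * (U * Uᵀ) * T * U := by
            simp only [Matrix.mul_assoc]
        _ = _ := by rw [hUU']; simp only [Matrix.mul_assoc, Matrix.one_mul]
    have e4 : T * P * T = T - μ • (T * L * T) := by
      rw [hTP, Matrix.sub_mul, Matrix.one_mul, Matrix.smul_mul]
    rw [e1, e2, e3, e4, hX, hτ]
    simp only [Matrix.mul_sub, Matrix.sub_mul, Matrix.mul_smul, Matrix.smul_mul, smul_sub, smul_smul]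
  set E : Matrix (Fin N) (Fin N) ℝ := Matrix.diagonal (fun i => if i = i0 then 0 else 1) with hE
  have hES : E * Sq = Sq := by
    rw [hE, hSq, Matrix.diagonal_mul_diagonal]; congr 1; ext i
    split_ifs with h
    · rw [h, hlam0]; simp
    · simp
  have hSE : Sq * E = Sq := by
    rw [hE, hSq, Matrix.diagonal_mul_diagonal]; congr 1; ext i
    split_ifs with h
    · rw [h, hlam0]; simp
    · simp
  have hEE : E * E = E := by
    rw [hE, Matrix.diagonal_mul_diagonal]; congr 1; ext i; simp
  have hEX : E * X = X := by
    rw [hX, Matrix.mul_smul]; simp only [← Matrix.mul_assoc, hES]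
  have hXE : X * E = X := by
    rw [hX, Matrix.smul_mul]; simp only [Matrix.mul_assoc, hSE]
  have hAs : (E - X)ᵀ = E - X := by
    rw [Matrix.transpose_sub, hXs, hE, Matrix.diagonal_transpose]
  have hAA : (E - X) - (E - X) * (E - X) = Y * Yᵀ := by
    rw [← hXY, Matrix.sub_mul, Matrix.mul_sub, Matrix.mul_sub, hEE, hEX, hXE]; abel
  have hAe : ∀ i j, (E - X) i j = (if i = j ∧ i ≠ i0 then 1 else 0) - X i j := by
    intro i j
    rw [Matrix.sub_apply, hE, Matrix.diagonal_apply]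
    by_cases h1 : i = j <;> by_cases h2 : i = i0 <;> simp [h1, h2]
  -- all-ones vector
  have hL1 : L *ᵥ (fun _ => (1:ℝ)) = 0 := by
    rw [hLd]; exact SimpleGraph.lapMatrix_mulVec_const_eq_zero G
  have hone : ∀ i, lam i * (u i ⬝ᵥ fun _ => (1:ℝ)) = 0 := by
    intro i
    have h1 : (L *ᵥ u i) ⬝ᵥ (fun _ => (1:ℝ)) = u i ⬝ᵥ (L *ᵥ (fun _ => (1:ℝ))) := by
      rw [Matrix.dotProduct_mulVec, ← Matrix.mulVec_transpose, hLs]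
    rw [hL1, hLd, heig, smul_dotProduct, dotProduct_zero, smul_eq_mul] at h1
    exact h1
  obtain ⟨s0, hs0⟩ := hS
  have hrank : (E - X).rank ≤ S.card - 1 := by
    set Si : Matrix (Fin N) (Fin N) ℝ :=
      Matrix.diagonal (fun i => if i = i0 then 0 else 1 / √(lam i)) with hSi
    have q1 : Sq * Si = E := by
      rw [hSq, hSi, Matrix.diagonal_mul_diagonal, hE]; congr 1; ext i
      split_ifs with h
      · simp
      · have := Real.sqrt_pos.2 (hpos i h); field_simp
    have q2 : Lm * Si = Sq := by
      rw [← hSqSq, Matrix.mul_assoc, q1, hSE]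
    have q3 : E - X = Sq * (Uᵀ * (T * P) * U) * Si := by
      rw [hMhat, Matrix.mul_sub, Matrix.sub_mul, Matrix.mul_one, q1, hX]
      simp only [Matrix.mul_smul, Matrix.smul_mul, Matrix.mul_assoc, q2]
    set Q : Matrix (Fin N) (Fin N) ℝ := Matrix.diagonal (fun j => if j ∈ S.erase s0 then 1 else 0)
      with hQ
    set e : Fin N → ℝ := fun j => if j = s0 then 1 else 0 with he
    set oS : Fin N → ℝ := P *ᵥ (fun _ => 1) with hoS
    have q4 : P - Matrix.vecMulVec oS e = Q * (1 - Matrix.vecMulVec (fun _ => 1) e) := by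
      ext i j
      rw [Matrix.sub_apply, hQ, Matrix.diagonal_mul, Matrix.sub_apply, Matrix.vecMulVec_apply,
        Matrix.vecMulVec_apply, hoS, hPd, Matrix.mulVec_diagonal, Matrix.diagonal_apply,
        Matrix.one_apply, he]
      by_cases h1 : i = s0
      · subst h1
        by_cases h2 : i = j
        · subst h2; simp [hs0]
        · have : ¬ (j = i) := fun h => h2 h.symm
          simp [h2, this]
      · by_cases h2 : i ∈ S <;> by_cases h3 : i = j <;> by_cases h4 : j = s0 <;> simp [h1, h2, h3, h4]
    have q5 : Sq * (Uᵀ * T) * Matrix.vecMulVec oS e = 0 := by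
      rw [Matrix.mul_vecMulVec]
      have : (Sq * (Uᵀ * T)) *ᵥ oS = 0 := by
        have r1 : T *ᵥ oS = fun _ => 1 := by
          have : oS = K *ᵥ (fun _ => 1) := by
            rw [hK, Matrix.add_mulVec, Matrix.smul_mulVec, hL1, smul_zero, add_zero]
          rw [this, Matrix.mulVec_mulVec, hTK, Matrix.one_mulVec]
        rw [← Matrix.mulVec_mulVec, ← Matrix.mulVec_mulVec, r1]
        ext i
        rw [hSq, Matrix.mulVec_diagonal]
        have r2 : (Uᵀ *ᵥ fun _ => (1:ℝ)) i = u i ⬝ᵥ fun _ => (1:ℝ) := rfl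
        rw [r2]
        rcases mul_eq_zero.1 (hone i) with h | h
        · rw [h]; simp
        · rw [h]; simp
      rw [this]; ext i j; simp [Matrix.vecMulVec_apply]
    have q6 : E - X = (Sq * (Uᵀ * T)) * Q * ((1 - Matrix.vecMulVec (fun _ => 1) e) * U * Si) := by
      rw [q3]
      calc Sq * (Uᵀ * (T * P) * U) * Si
          = (Sq * (Uᵀ * T) * P - Sq * (Uᵀ * T) * Matrix.vecMulVec oS e) * (U * Si) := by
            rw [q5, sub_zero]; simp only [Matrix.mul_assoc]
        _ = (Sq * (Uᵀ * T) * (P - Matrix.vecMulVec oS e)) * (U * Si) := by rw [Matrix.mul_sub]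
        _ = _ := by rw [q4]; simp only [Matrix.mul_assoc]
    rw [q6]
    refine ((Matrix.rank_mul_le_left _ _).trans (Matrix.rank_mul_le_right _ _)).trans ?_
    rw [hQ, Matrix.rank_diagonal, Fintype.card_subtype, ← Finset.card_erase_of_mem hs0]
    apply le_of_eq; congr 1; ext i; simp
  -- the mean part
  have hm0 : 0 < (S.card : ℝ) := by exact_mod_cast Finset.card_pos.2 ⟨s0, hs0⟩
  set κ := u i0 i0 with hκ
  have hu0 : ∀ i, u i0 i = κ := by
    intro i
    have h1 : (G.lapMatrix ℝ) *ᵥ (u i0) = 0 := by rw [heig, hlam0, zero_smul]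
    exact (SimpleGraph.lapMatrix_mulVec_eq_zero_iff_forall_reachable G).1 h1 i i0
      (hG.preconnected i i0)
  have hκN : (N : ℝ) * κ ^ 2 = 1 := by
    have := hortho i0 i0
    simp only [dotProduct, hu0, sum_const, card_univ, Fintype.card_fin, if_true] at this
    rw [← this, nsmul_eq_mul, sq]
  have hκ0 : κ ≠ 0 := by
    rintro h; rw [h] at hκN; simp at hκN
  set v := T *ᵥ u i0 with hv
  set c := P *ᵥ v with hc
  set sv : Fin N → ℝ := fun i => if i ∈ S then 1 / (S.card * κ) else 0 with hsv
  have pars : ∀ a b : Fin N → ℝ, ∑ j, (u j ⬝ᵥ a) * (u j ⬝ᵥ b) = a ⬝ᵥ b := by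
    intro a b
    have h1 : ∀ a : Fin N → ℝ, (fun j => u j ⬝ᵥ a) = Uᵀ *ᵥ a := fun a => rfl
    have : ∑ j, (u j ⬝ᵥ a) * (u j ⬝ᵥ b) = (Uᵀ *ᵥ a) ⬝ᵥ (Uᵀ *ᵥ b) := rfl
    rw [this, Matrix.dotProduct_mulVec, Matrix.vecMul_transpose, Matrix.mulVec_mulVec, hUU',
      Matrix.one_mulVec]
  have hce : ∀ i, c i = if i ∈ S then v i else 0 := by
    intro i; rw [hc, hPd, Matrix.mulVec_diagonal]; simp
  have hτc : ∀ j, τ i0 j = u j ⬝ᵥ v := by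
    intro j
    rw [← hτs, Matrix.transpose_apply, hτ, Matrix.mul_assoc]
    rfl
  have hcj : ∀ j, u j ⬝ᵥ c = (if j = i0 then 1 else 0) - μ * τ i0 j * lam j := by
    intro j
    have h1 : c + μ • (L *ᵥ v) = u i0 := by
      rw [hc, ← Matrix.smul_mulVec, ← Matrix.add_mulVec, ← hK, hv, Matrix.mulVec_mulVec, hKT,
        Matrix.one_mulVec]
    have h2 := congrArg (fun t => u j ⬝ᵥ t) h1
    simp only [dotProduct_add, dotProduct_smul, hortho, smul_eq_mul] at h2
    have h3 : u j ⬝ᵥ (L *ᵥ v) = lam j * (u j ⬝ᵥ v) := by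
      rw [Matrix.dotProduct_mulVec, ← Matrix.mulVec_transpose, hLs, hLd, heig, smul_dotProduct,
        smul_eq_mul]
    rw [h3] at h2
    rw [hτc]
    linarith
  have hc0 : u i0 ⬝ᵥ c = 1 := by rw [hcj, hlam0]; simp
  have hSv : ∑ i ∈ S, v i = 1 / κ := by
    have : u i0 ⬝ᵥ c = κ * ∑ i ∈ S, v i := by
      simp only [dotProduct, hu0, hce, mul_ite, mul_zero]
      rw [← sum_filter, mul_sum]; simp
    rw [this] at hc0
    field_simp; linarith
  have hNm : 1 / (S.card * κ) * (1 / κ) = N / S.card := by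
    field_simp; linarith
  have d1 : sv ⬝ᵥ sv = N / S.card := by
    simp only [dotProduct, hsv, mul_ite, mul_zero, ite_mul, zero_mul]
    rw [← hNm]
    simp
    field_simp
  have d2 : u i0 ⬝ᵥ sv = 1 := by
    simp only [dotProduct, hu0, hsv, mul_ite, mul_zero]
    simp
    field_simp
  have d3 : sv ⬝ᵥ v = N / S.card := by
    simp only [dotProduct, hsv, ite_mul, zero_mul]
    rw [← hNm, ← hSv, mul_sum]; simp
  have d4 : sv ⬝ᵥ c = N / S.card := by
    rw [← d3]
    simp only [dotProduct, hsv, hce]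
    apply sum_congr rfl; intro i _; split_ifs <;> simp
  have d5 : c ⬝ᵥ v = c ⬝ᵥ c := by
    simp only [dotProduct, hce]
    apply sum_congr rfl; intro i _; split_ifs <;> simp
  have d6 : (N : ℝ) / S.card ≤ c ⬝ᵥ c := by
    have h1 : 0 ≤ (c - sv) ⬝ᵥ (c - sv) := by
      simp only [dotProduct]; exact sum_nonneg (fun i _ => mul_self_nonneg _)
    simp only [sub_dotProduct, dotProduct_sub, dotProduct_comm c sv, d1, d4] at h1
    linarith
  have d7 : ∑ j, (u j ⬝ᵥ (sv - c)) * (u j ⬝ᵥ v) ≤ 0 := by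
    rw [pars, sub_dotProduct, d3, d5]; linarith
  refine ⟨τ, X, E - X, fun j => u j ⬝ᵥ sv, hXe, hAe, ?_, ?_, hXs, hAs, row_of_sq X Y hXs hXY,
    row_of_sq _ Y hAs hAA, hrank, ?_, d2, ?_⟩
  · have hUKU : UK = U.submatrix id (Fin.castLE hkN) := by rw [hUK]; rfl
    rw [← frob_orth U hUU', frob_sum]
    have : Uᵀ * (UK - T * P * UK) = (μ • (τ * Lm)).submatrix id (Fin.castLE hkN) := by
      have h1 : μ • (τ * Lm) = Uᵀ * (U - T * P * U) := by
        rw [Matrix.mul_sub, hUU, ← Matrix.mul_assoc, hMhat]; simp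
      rw [h1, hUKU]; rfl
    rw [this]
    apply sum_congr rfl; intro j _; apply sum_congr rfl; intro i _
    rw [Matrix.submatrix_apply, Matrix.smul_apply, hLm, Matrix.mul_diagonal, smul_eq_mul]
    simp only [id]; ring
  · rw [← frob_orth U hUU', ← frob_orth' U hUU', frob_sum, hMhat]
    simp only [hMe]
  · rw [← d1, ← pars]; simp only [sq]
  · rw [← Finset.add_sum_erase univ _ (mem_univ i0)] at d7
    have h0 : u i0 ⬝ᵥ (sv - c) = 0 := by rw [dotProduct_sub, d2, hc0]; simp
    rw [h0, zero_mul, zero_add] at d7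
    have : ∑ j ∈ univ.erase i0, (u j ⬝ᵥ (sv - c)) * (u j ⬝ᵥ v) = - (1/μ) *
      ∑ j ∈ univ.erase i0, ((u j ⬝ᵥ sv) - (- (μ * τ i0 j * lam j))) *
        (- (μ * τ i0 j * lam j)) / lam j := by
      rw [mul_sum]
      apply sum_congr rfl; intro j hj
      have hj0 : j ≠ i0 := (mem_erase.1 hj).1
      have := hpos j hj0
      rw [dotProduct_sub, hcj, if_neg hj0, hτc]
      field_simp
      ring
    rw [this] at d7
    have h1 : 0 < 1 / μ := by positivity
    by_contra hneg
    push Not at hneg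
    nlinarith

noncomputable def extM {N : ℕ} (Z : Matrix (Fin N) (Fin N) ℝ) (i j : ℕ) : ℝ :=
  if h : i < N ∧ j < N then Z ⟨i, h.1⟩ ⟨j, h.2⟩ else 0

lemma ext_of {N : ℕ} (Z : Matrix (Fin N) (Fin N) ℝ) {i j : ℕ} (hi : i < N) (hj : j < N) :
    extM Z i j = Z ⟨i, hi⟩ ⟨j, hj⟩ := by simp [extM, hi, hj]

lemma ext_fin {N : ℕ} (Z : Matrix (Fin N) (Fin N) ℝ) (i j : Fin N) :
    extM Z i j = Z i j := by simp [extM]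

lemma sum_fin_filter {N : ℕ} (s : Finset ℕ) (hs : s ⊆ range N) (g : ℕ → ℝ) :
    ∑ i ∈ s, g i = ∑ i ∈ (univ : Finset (Fin N)).filter (fun i : Fin N => (i : ℕ) ∈ s), g i := by
  rw [sum_filter, ← Finset.sum_range (fun i => if i ∈ s then g i else 0), ← sum_filter,
    filter_mem_eq_inter, inter_eq_right.2 hs]

lemma core_fin {N k p : ℕ} (hkN : k ≤ N) (f : ℕ → ℝ) (h0 : ∀ a, 1 ≤ a → a < N → 0 < f a)
    (hm : ∀ a b, a ≤ b → b < N → f a ≤ f b) (Z A : Matrix (Fin N) (Fin N) ℝ)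
    (hZ : Zᵀ = Z) (hA : Aᵀ = A) (hZr : ∀ i, ∑ l, Z i l ^ 2 ≤ Z i i)
    (hAr : ∀ i, ∑ l, A i l ^ 2 ≤ A i i) (hp : A.rank ≤ p) (hZA : ∀ i j, i ≠ j → Z i j ^ 2 = A i j ^ 2) :
    ∑ j ∈ Ico 1 k, ∑ i ∈ Ico 1 N, extM Z i j ^ 2 * (f j / f i) ≤
      ∑ j ∈ Ico 1 k, extM Z j j +
      ∑ l ∈ Ico 1 (p+1), (if l < k - l then phi (f l) (f (k-l)) / 4 else 0) := by
  have hs : ∀ i j, Z i j = Z j i := fun i j => by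
    conv_lhs => rw [← hZ]
    rfl
  apply core_sum N k p hkN f h0 hm
  · intro i j
    unfold extM
    by_cases h : i < N ∧ j < N
    · rw [dif_pos h, dif_pos h.symm, hs]
    · rw [dif_neg h, dif_neg (fun h' => h h'.symm)]
  · intro j hj
    have h1 := hZr ⟨j, hj⟩
    rw [ext_of Z hj hj]
    refine le_trans ?_ h1
    rw [sum_fin_filter (N := N) (Ico 1 N) (fun x hx => by simp at hx ⊢; omega)]
    refine (sum_le_sum_of_subset_of_nonneg (subset_univ _) (fun _ _ _ => sq_nonneg _)).trans ?_
    apply le_of_eq; apply sum_congr rfl; intro i _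
    rw [ext_of Z i.2 hj, hs]
  · intro a b ha hab hb
    rw [sum_fin_filter (N := N) (Ico 1 (a+1)) (fun x hx => by simp at hx ⊢; omega)]
    simp_rw [sum_fin_filter (N := N) (Ico (b+1) k) (fun x hx => by simp at hx ⊢; omega)]
    refine le_trans (le_of_eq ?_) (block_bd A hA p hp hAr
      (univ.filter (fun i : Fin N => (i : ℕ) ∈ Ico 1 (a+1)))
      (univ.filter (fun i : Fin N => (i : ℕ) ∈ Ico (b+1) k)) ?_)
    · apply sum_congr rfl; intro i hi; apply sum_congr rfl; intro j hj
      simp only [mem_filter, mem_univ, true_and, mem_Ico] at hi hj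
      rw [ext_fin, hZA]
      rintro rfl; omega
    · rw [disjoint_left]
      intro i hi hj
      simp only [mem_filter, mem_univ, true_and, mem_Ico] at hi hj
      omega

lemma omega_div (x y : ℝ) (hx : 0 < x) (hy : 0 < y) : omegaFn (y / x) = om x y := by
  have hd : 0 < y / x := by positivity
  have h := Real.sq_sqrt hd.le
  have hs := Real.sqrt_pos.2 hd
  have : omegaFn (y / x) = (√(y/x)^2 + 2 + 1 / √(y/x)^2) / 4 := by
    unfold omegaFn; field_simp; ring
  rw [this, h]
  unfold om; field_simp; ring

lemma omega_one : omegaFn 1 = 1 := by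
  unfold omegaFn; norm_num

lemma om_phi (x y : ℝ) (hx : 0 < x) (hy : 0 < y) : om x y = 1 + phi x y / 4 := by
  unfold om phi; field_simp; ring

lemma eig1_of {N : ℕ} (lam : Fin N → ℝ) {l : ℕ} (h : l < N) : eig1 lam (l + 1) = lam ⟨l, h⟩ := by
  simp [eig1, h]

lemma omega_sum {N k m : ℕ} (hkN : k ≤ N) (hm1 : 1 ≤ m) (hmN : m ≤ N) (lam : Fin N → ℝ)
    (f : ℕ → ℝ) (hf : ∀ l, f l = eig1 lam (l+1))
    (h0 : ∀ a, 1 ≤ a → a < N → 0 < f a)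
    (hm : ∀ a b, a ≤ b → b < N → f a ≤ f b) :
    ∑ i ∈ Icc 2 m, omegaFn (max 1 (eig1 lam (k + 2 - i) / eig1 lam i)) =
      ((m - 1 : ℕ) : ℝ) +
      ∑ l ∈ Ico 1 (m-1+1), (if l < k - l then phi (f l) (f (k-l)) / 4 else 0) := by
  have e1 : ∑ i ∈ Icc 2 m, omegaFn (max 1 (eig1 lam (k + 2 - i) / eig1 lam i)) =
      ∑ l ∈ Ico 1 (m-1+1), omegaFn (max 1 (eig1 lam (k + 1 - l) / eig1 lam (l+1))) := by
    have : Icc 2 m = Ico (1+1) (m-1+1+1) := by ext i; simp only [mem_Icc, mem_Ico]; omega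
    rw [this, ← Finset.sum_Ico_add' (fun i => omegaFn (max 1 (eig1 lam (k + 2 - i) / eig1 lam i)))]
    apply sum_congr rfl; intro l _
    rw [show k + 2 - (l+1) = k + 1 - l by omega]
  have e2 : ((m - 1 : ℕ) : ℝ) = ∑ l ∈ Ico 1 (m-1+1), (1:ℝ) := by simp
  rw [e1, e2, ← sum_add_distrib]
  apply sum_congr rfl; intro l hl
  rw [mem_Ico] at hl
  have e3 : eig1 lam (k + 1 - l) = f (k - l) := by
    rw [hf]
    by_cases h : l ≤ k
    · rw [show k + 1 - l = k - l + 1 by omega]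
    · rw [show k + 1 - l = 0 by omega, show k - l = 0 by omega]; simp [eig1]
  rw [e3, ← hf]
  have hl0 := h0 l hl.1 (by omega)
  split_ifs with h
  · have hkl := h0 (k-l) (by omega) (by omega)
    have := hm l (k-l) h.le (by omega)
    rw [max_eq_right (by rw [one_le_div hl0]; exact this), omega_div _ _ hl0 hkl, om_phi _ _ hl0 hkl]
  · have := hm (k-l) l (by omega) (by omega)
    rw [max_eq_left (by rw [div_le_one hl0]; exact this), omega_one, add_zero]

end Kant

open Kant Finset in
/-- Paper's Corollary 3 (`unif_ub_xi_1_MSE`): for any nonempty sample set `S` of size `m`,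
any `μ > 0` and any `σ`, the average MSE of GLR reconstruction satisfies
`ξ₁(S) + σ²·ξ₂(S) ≤ (k + B_k(m)) + σ²·B(m)`, uniformly in `μ` and in the choice of `S`. -/
theorem stmt_15 (N k : ℕ) (hN : 2 ≤ N) (hk2 : 2 ≤ k) (hkN : k ≤ N)
    (G : SimpleGraph (Fin N)) [DecidableRel G.Adj] (hG : G.Connected)
    (lam : Fin N → ℝ) (hmono : StrictMono lam) (hlam0 : lam ⟨0, by omega⟩ = 0)
    (u : Fin N → Fin N → ℝ)
    (hortho : ∀ i j, u i ⬝ᵥ u j = if i = j then (1 : ℝ) else 0)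
    (heig : ∀ i, (G.lapMatrix ℝ).mulVec (u i) = lam i • u i)
    (μ : ℝ) (hμ : 0 < μ)
    (S : Finset (Fin N)) (hS : S.Nonempty) (σ : ℝ) :
    let L := G.lapMatrix ℝ
    let UK : Matrix (Fin N) (Fin k) ℝ := Matrix.of fun i j => u (Fin.castLE hkN j) i
    let P : Matrix (Fin N) (Fin N) ℝ := Matrix.diagonal fun j => if j ∈ S then 1 else 0
    let m := S.card
    let xi1 := frobSq (UK - (P + μ • L)⁻¹ * P * UK)
    let xi2 := frobSq ((P + μ • L)⁻¹ * P)
    xi1 + σ ^ 2 * xi2 ≤ ((k : ℝ) + Bbl lam k m) + σ ^ 2 * Bfull lam m := by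
  intro L UK P m xi1 xi2
  have hN0 : 0 < N := by omega
  have hpos : ∀ i, i ≠ (⟨0, hN0⟩ : Fin N) → 0 < lam i := by
    intro i hi
    rw [← hlam0]
    apply hmono
    rw [Fin.lt_def]
    have : (i : ℕ) ≠ 0 := fun h => hi (Fin.ext h)
    show 0 < (i : ℕ)
    omega
  have hnn : ∀ i, 0 ≤ lam i := by
    intro i
    by_cases hi : i = (⟨0, hN0⟩ : Fin N)
    · rw [hi]; exact hlam0.ge
    · exact (hpos i hi).le
  obtain ⟨τ, X, A, s, hXe, hAe, hxi1, hxi2, hXs, hAs, hXr, hAr, hrank, hs2, hs0, hmean⟩ :=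
    setup hN0 hkN G hG lam hnn hlam0 hpos u hortho heig μ hμ S hS L UK P rfl rfl rfl
  have hm1 : 1 ≤ m := Finset.card_pos.2 hS
  have hmN : m ≤ N := by simpa using Finset.card_le_univ S
  set f : ℕ → ℝ := fun l => eig1 lam (l+1) with hf
  have hfl : ∀ l (h : l < N), f l = lam ⟨l, h⟩ := fun l h => eig1_of lam h
  have h0 : ∀ a, 1 ≤ a → a < N → 0 < f a := by
    intro a ha1 haN
    rw [hfl a haN]
    apply hpos
    intro h
    have := congrArg Fin.val h
    simp at this; omega
  have hfm : ∀ a b, a ≤ b → b < N → f a ≤ f b := by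
    intro a b hab hb
    rw [hfl a (by omega), hfl b hb]
    exact hmono.monotone hab
  set i0 : Fin N := ⟨0, hN0⟩ with hi0
  set D : Matrix (Fin N) (Fin N) ℝ := Matrix.of fun i j => μ * τ i j * lam j with hD
  have hDX : ∀ i j : ℕ, 1 ≤ i → i < N → j < N → extM D i j ^ 2 = extM X i j ^ 2 * (f j / f i) := by
    intro i j hi hiN hj
    have h1 := h0 i hi hiN
    rw [ext_of D hiN hj, ext_of X hiN hj, hXe, hfl i hiN, hfl j hj, hD, Matrix.of_apply]
    rw [hfl i hiN] at h1
    simp only [mul_pow, Real.sq_sqrt (hnn _)]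
    field_simp
  -- mean part
  have hmeank : ∀ k', 2 ≤ k' → k' ≤ N → ∑ j ∈ Ico 1 k', extM D 0 j ^ 2 ≤
      omegaFn (eig1 lam k' / eig1 lam 2) * (N / m) - 1 := by
    intro k' hk2' hkN'
    have hf1 : 0 < f 1 := h0 1 le_rfl (by omega)
    have hfk : 0 < f (k'-1) := h0 _ (by omega) (by omega)
    have e : omegaFn (eig1 lam k' / eig1 lam 2) = om (f 1) (f (k'-1)) := by
      rw [← omega_div _ _ hf1 hfk, hf]
      simp only
      rw [show k' - 1 + 1 = k' by omega]
    set sn : ℕ → ℝ := fun j => if h : j < N then s ⟨j, h⟩ else 0 with hsn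
    have hsnf : ∀ j : Fin N, sn j = s j := fun j => by simp [hsn]
    have herase : (univ.erase i0) = (univ : Finset (Fin N)).filter (fun i : Fin N => (i : ℕ) ∈ Ico 1 N) := by
      ext i
      simp only [mem_erase, mem_univ, and_true, mem_filter, true_and, mem_Ico, hi0, Fin.ext_iff, ne_eq]
      have := i.2
      omega
    have hsub : Ico 1 N ⊆ range N := fun x hx => by simp at hx ⊢; omega
    have hsc := scalar_sum (Ico 1 N) (Ico 1 k') (Ico_subset_Ico le_rfl hkN') f sn
      (fun j => - extM D 0 j) (f 1) (f (k'-1)) hf1 (hfm _ _ (by omega) (by omega))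
      (fun j hj => by
        rw [mem_Ico] at hj
        exact ⟨hfm _ _ (by omega) (by omega), hfm _ _ (by omega) (by omega)⟩)
      (fun j hj hj' => by
        rw [mem_Ico] at hj hj'
        exact hfm _ _ (by omega) (by omega))
      (by
        rw [sum_fin_filter (N := N) _ hsub, ← herase]
        refine hmean.trans (le_of_eq ?_)
        apply sum_congr rfl; intro j _
        rw [hsnf, ext_of D hN0 j.2, hfl j j.2]
        rfl)
    have hss : ∑ j ∈ Ico 1 N, sn j ^ 2 = N / m - 1 := by
      rw [sum_fin_filter (N := N) _ hsub, ← herase]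
      simp only [hsnf]
      have := Finset.add_sum_erase univ (fun j => s j ^ 2) (mem_univ i0)
      simp only [hs0, hs2] at this
      linarith
    rw [hss] at hsc
    simp only [neg_sq] at hsc
    have h1 := one_le_om _ _ hf1 hfk
    rw [e]
    linarith
  have hz : ∀ i, extM D i 0 = 0 := by
    intro i
    by_cases hi : i < N
    · rw [ext_of D hi hN0, hD, Matrix.of_apply, hlam0, mul_zero]
    · simp [extM, hi]
  -- xi1
  have hX1 : xi1 ≤ (k : ℝ) + Bbl lam k m := by
    have e1 : xi1 = ∑ j ∈ Ico 1 k, (extM D 0 j ^ 2 + ∑ i ∈ Ico 1 N, extM D i j ^ 2) := by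
      show frobSq (UK - (P + μ • L)⁻¹ * P * UK) = _
      rw [hxi1]
      have : ∑ j : Fin k, ∑ i, (μ * τ i (Fin.castLE hkN j) * lam (Fin.castLE hkN j)) ^ 2 =
          ∑ j ∈ range k, ∑ i ∈ range N, extM D i j ^ 2 := by
        rw [Finset.sum_range]
        apply sum_congr rfl; intro j _
        rw [Finset.sum_range]
        apply sum_congr rfl; intro i _
        rw [ext_of D i.2 (by omega : (j : ℕ) < N)]
        rfl
      rw [this, range_eq_Ico, sum_eq_sum_Ico_succ_bot (by omega)]
      simp only [hz]
      simp only [ne_eq, OfNat.ofNat_ne_zero, not_false_eq_true, zero_pow, sum_const_zero, zero_add]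
      apply sum_congr rfl; intro j _
      rw [range_eq_Ico, sum_eq_sum_Ico_succ_bot hN0]
    have e2 := core_fin hkN f h0 hfm X A hXs hAs hXr hAr hrank (by
      intro i j hij
      rw [hAe, if_neg (fun h => hij h.1)]; ring)
    have e3 : ∑ j ∈ Ico 1 k, extM X j j ≤ k - 1 := by
      calc _ ≤ ∑ j ∈ Ico 1 k, (1:ℝ) := by
            apply sum_le_sum; intro j hj
            rw [mem_Ico] at hj
            have hjN : j < N := by omega
            rw [ext_of X hjN hjN]
            have h1 := hXr ⟨j, hjN⟩
            have h2 : X ⟨j, hjN⟩ ⟨j, hjN⟩ ^ 2 ≤ ∑ l, X ⟨j, hjN⟩ l ^ 2 :=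
              Finset.single_le_sum (f := fun l => X ⟨j, hjN⟩ l ^ 2)
                (fun _ _ => sq_nonneg _) (mem_univ _)
            nlinarith
        _ = k - 1 := by
            rw [sum_const, Nat.card_Ico, nsmul_eq_mul, mul_one, Nat.cast_sub (by omega)]; simp
    have e4 : ∑ j ∈ Ico 1 k, ∑ i ∈ Ico 1 N, extM D i j ^ 2 =
        ∑ j ∈ Ico 1 k, ∑ i ∈ Ico 1 N, extM X i j ^ 2 * (f j / f i) := by
      apply sum_congr rfl; intro j hj; apply sum_congr rfl; intro i hi
      rw [mem_Ico] at hi hj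
      exact hDX i j hi.1 hi.2 (by omega)
    rw [e1, sum_add_distrib, e4]
    have e5 := hmeank k hk2 hkN
    unfold Bbl
    rw [omega_sum hkN hm1 hmN lam f (fun _ => rfl) h0 hfm]
    have e6 : (0:ℝ) ≤ ((m - 1 : ℕ) : ℝ) := Nat.cast_nonneg _
    linarith
  -- xi2
  have hX2 : xi2 ≤ Bfull lam m := by
    set M : Matrix (Fin N) (Fin N) ℝ := Matrix.of fun i j =>
      (if i = j then 1 else 0) - μ * τ i j * lam j with hM
    have e1 : xi2 = 1 + ∑ j ∈ Ico 1 N, (extM D 0 j ^ 2 + ∑ i ∈ Ico 1 N, extM M i j ^ 2) := by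
      show frobSq ((P + μ • L)⁻¹ * P) = _
      rw [hxi2]
      have : ∑ j, ∑ i, ((if i = j then 1 else 0) - μ * τ i j * lam j) ^ 2 =
          ∑ j ∈ range N, ∑ i ∈ range N, extM M i j ^ 2 := by
        rw [Finset.sum_range]
        apply sum_congr rfl; intro j _
        rw [Finset.sum_range]
        apply sum_congr rfl; intro i _
        rw [ext_fin]
        rfl
      rw [this, range_eq_Ico, sum_eq_sum_Ico_succ_bot hN0]
      congr 1
      · rw [sum_eq_sum_Ico_succ_bot hN0]
        have h1 : extM M 0 0 = 1 := by
          rw [ext_of M hN0 hN0, hM, Matrix.of_apply, hlam0]; simp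
        have h2 : ∑ i ∈ Ico (0+1) N, extM M i 0 ^ 2 = 0 := by
          apply sum_eq_zero; intro i hi
          rw [mem_Ico] at hi
          rw [ext_of M hi.2 hN0, hM, Matrix.of_apply, hlam0, if_neg (by
            rw [Fin.ext_iff]; show ¬ (i = 0); omega)]
          simp
        rw [h1, h2]; simp
      · apply sum_congr rfl; intro j hj
        rw [mem_Ico] at hj
        rw [sum_eq_sum_Ico_succ_bot hN0]
        congr 1
        rw [ext_of M hN0 hj.2, ext_of D hN0 hj.2, hM, Matrix.of_apply, hD, Matrix.of_apply, if_neg (by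
            rw [Fin.ext_iff]; show ¬ (0 = j); omega)]
        ring
    have e2 := core_fin le_rfl f h0 hfm A A hAs hAs hAr hAr hrank (fun _ _ _ => rfl)
    have e3 : ∑ j ∈ Ico 1 N, extM A j j ≤ ((m - 1 : ℕ) : ℝ) := by
      refine le_trans ?_ (trace_bd A hAs (m-1) hrank hAr)
      rw [sum_fin_filter (N := N) _ (fun x hx => by simp at hx ⊢; omega)]
      simp only [ext_fin]
      apply sum_le_sum_of_subset_of_nonneg (subset_univ _)
      intro i _ _
      exact (sum_nonneg (fun _ _ => sq_nonneg _)).trans (hAr i)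
    have e4 : ∑ j ∈ Ico 1 N, ∑ i ∈ Ico 1 N, extM M i j ^ 2 =
        ∑ j ∈ Ico 1 N, ∑ i ∈ Ico 1 N, extM A i j ^ 2 * (f j / f i) := by
      apply sum_congr rfl; intro j hj; apply sum_congr rfl; intro i hi
      rw [mem_Ico] at hi hj
      have hd := hDX i j hi.1 hi.2 (by omega)
      by_cases hij : i = j
      · subst hij
        have hfi := h0 i hi.1 hi.2
        have hne : (⟨i, hi.2⟩ : Fin N) ≠ i0 := by
          rw [hi0, ne_eq, Fin.ext_iff]; show ¬ (i = 0); omega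
        rw [div_self hfi.ne', mul_one, ext_of M hi.2 hi.2, ext_of A hi.2 hi.2, hAe, hXe, hM,
          Matrix.of_apply, if_pos rfl, if_pos ⟨rfl, hne⟩]
        have hq := Real.mul_self_sqrt (hnn ⟨i, hi.2⟩)
        congr 1
        linear_combination (-(μ * τ ⟨i, hi.2⟩ ⟨i, hi.2⟩)) * (-1) * hq
      · have hne : (⟨i, hi.2⟩ : Fin N) ≠ ⟨j, hj.2⟩ := by
          rw [ne_eq, Fin.ext_iff]; exact hij
        have a1 : extM M i j ^ 2 = extM D i j ^ 2 := by
          rw [ext_of M hi.2 hj.2, ext_of D hi.2 hj.2, hM, Matrix.of_apply, if_neg hne, hD,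
            Matrix.of_apply]; ring
        have a2 : extM A i j ^ 2 = extM X i j ^ 2 := by
          rw [ext_of A hi.2 hj.2, ext_of X hi.2 hj.2, hAe, if_neg (fun h => hne h.1)]; ring
        rw [a1, a2, hd]
    rw [e1, sum_add_distrib, e4]
    have e5 := hmeank N hN le_rfl
    unfold Bfull
    rw [omega_sum le_rfl hm1 hmN lam f (fun _ => rfl) h0 hfm]
    linarith
  have := mul_le_mul_of_nonneg_left hX2 (sq_nonneg σ)
  linarith
end
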